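/- arXiv:2109.04106 — 2 statements merged into one kernel-verified Lean document; each statement's English description precedes it below -/
import Mathlib

section
/- Let d be a positive integer. There exists a constant c > 0 such that for every positive integer n, every choice of points x_1, …, x_n ∈ S^d and every choice of weights w_1, …, w_n ∈ ℝ, the weighted spherical L_2-discrepancy satisfies D_2({(x_j, w_j)}_{j=1}^n) ≥ c·n^{−1/2 − 1/(2d)}. -/
open MeasureTheory Metric
open scoped RealInnerProductSpace

noncomputable section

/-- The unit sphere `S^d ⊂ ℝ^{d+1}`. -/
abbrev Sph (d : ℕ) : Type := sphere (0 : EuclideanSpace ℝ (Fin (d + 1))) 1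

/-- The normalized rotation-invariant (uniform) probability measure `σ_d` on `S^d`. -/
def sigmaSph (d : ℕ) : Measure (Sph d) :=
  ((volume : Measure (EuclideanSpace ℝ (Fin (d + 1)))).toSphere Set.univ)⁻¹ •
    (volume : Measure (EuclideanSpace ℝ (Fin (d + 1)))).toSphere

/-- The spherical cap `C(z,t) = {y ∈ S^d : z·y ≥ t}`. -/
def sphCap {d : ℕ} (z : Sph d) (t : ℝ) : Set (Sph d) :=
  {y : Sph d | t ≤ ⟪(z : EuclideanSpace ℝ (Fin (d + 1))), (y : EuclideanSpace ℝ (Fin (d + 1)))⟫}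

/-- The weighted spherical `L_2`-discrepancy of points `x` with weights `w`. -/
def sphDisc {d n : ℕ} (x : Fin n → Sph d) (w : Fin n → ℝ) : ℝ :=
  Real.sqrt (∫ t in Set.Icc (-1 : ℝ) 1, ∫ z, (∑ j, w j *
      (sphCap z t).indicator (fun _ => (1 : ℝ)) (x j) -
      ((sigmaSph d) (sphCap z t)).toReal) ^ 2 ∂(sigmaSph d))

open scoped Pointwise

/-- The ambient Euclidean space of the sphere `S^d`. -/
abbrev Amb (d : ℕ) : Type := EuclideanSpace ℝ (Fin (d + 1))

instance isProbabilityMeasure_sigmaSph (d : ℕ) : IsProbabilityMeasure (sigmaSph d) := by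
  refine ⟨?_⟩
  have h0 : (volume : Measure (Amb d)).toSphere Set.univ ≠ 0 := by
    rw [Ne, Measure.measure_univ_eq_zero]
    exact Measure.toSphere_ne_zero _
  simp only [sigmaSph, Measure.smul_apply, smul_eq_mul]
  exact ENNReal.inv_mul_cancel h0 (measure_ne_top _ _)

/-- The action of a linear isometry on the sphere. -/
def sphMap {d : ℕ} (R : Amb d ≃ₗᵢ[ℝ] Amb d) (z : Sph d) : Sph d :=
  ⟨R z, by simp⟩

lemma continuous_sphMap {d : ℕ} (R : Amb d ≃ₗᵢ[ℝ] Amb d) : Continuous (sphMap R) := by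
  unfold sphMap; fun_prop

lemma measurePreserving_sphMap {d : ℕ} (R : Amb d ≃ₗᵢ[ℝ] Amb d) :
    MeasurePreserving (sphMap R) (sigmaSph d) (sigmaSph d) := by
  have key : MeasurePreserving (sphMap R) (volume : Measure (Amb d)).toSphere
      (volume : Measure (Amb d)).toSphere := by
    refine ⟨(continuous_sphMap R).measurable, ?_⟩
    ext s hs
    rw [Measure.map_apply (continuous_sphMap R).measurable hs, Measure.toSphere_apply' _ hs,
      Measure.toSphere_apply' _ ((continuous_sphMap R).measurable hs)]
    congr 1
    rw [← MeasurePreserving.measure_preimage_equiv (f := R.toHomeomorph.toMeasurableEquiv)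
      (LinearIsometryEquiv.measurePreserving R) (Set.Ioo (0 : ℝ) 1 • (Subtype.val '' s))]
    congr 1
    ext v
    simp only [Set.mem_smul, Set.mem_image, Set.mem_preimage]
    constructor
    · rintro ⟨t, ht, _, ⟨y, hy, rfl⟩, rfl⟩
      exact ⟨t, ht, _, ⟨sphMap R y, hy, rfl⟩, by simp [sphMap]⟩
    · rintro ⟨t, ht, _, ⟨y, hy, rfl⟩, h⟩
      refine ⟨t, ht, _, ⟨sphMap R.symm y, ?_, rfl⟩, ?_⟩
      · have : sphMap R (sphMap R.symm y) = y := by ext1; simp [sphMap]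
        simpa [this] using hy
      · apply R.injective
        simpa [sphMap] using h
  exact key.smul_measure _

lemma integral_sigmaSph_comp_isometry {d : ℕ} (R : Amb d ≃ₗᵢ[ℝ] Amb d) (f : Amb d → ℝ) :
    ∫ z : Sph d, f (R z) ∂(sigmaSph d) = ∫ z : Sph d, f z ∂(sigmaSph d) := by
  have e : MeasurableEmbedding (sphMap R) := by
    refine (Homeomorph.mk (Equiv.mk (sphMap R) (sphMap R.symm) ?_ ?_) (continuous_sphMap R)
      (continuous_sphMap R.symm)).measurableEmbedding
    · intro y; ext1; simp [sphMap]
    · intro y; ext1; simp [sphMap]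
  exact (measurePreserving_sphMap R).integral_comp e (fun z : Sph d => f z)

lemma exists_isometry_map_eq {d : ℕ} {v w : Amb d} (h : ‖v‖ = ‖w‖) :
    ∃ R : Amb d ≃ₗᵢ[ℝ] Amb d, R v = w :=
  ⟨_, Submodule.reflection_sub h⟩

lemma integral_inner_sigmaSph {d : ℕ} (v : Amb d) :
    ∫ z : Sph d, ⟪(z : Amb d), v⟫ ∂(sigmaSph d) = 0 := by
  have h := integral_sigmaSph_comp_isometry (LinearIsometryEquiv.neg ℝ) (fun z : Amb d => ⟪z, v⟫)
  simp only [LinearIsometryEquiv.coe_neg, inner_neg_left, integral_neg] at h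
  linarith

lemma abs_inner_sph_le {d : ℕ} (z : Sph d) (v : Amb d) : |⟪(z : Amb d), v⟫| ≤ ‖v‖ := by
  have := abs_real_inner_le_norm (z : Amb d) v
  simpa using this

/-- The mean of `|z · v|` over the sphere is a positive multiple of `‖v‖`. -/
lemma exists_integral_abs_inner_eq (d : ℕ) :
    ∃ c : ℝ, 0 < c ∧ ∀ v : Amb d, ∫ z : Sph d, |⟪(z : Amb d), v⟫| ∂(sigmaSph d) = c * ‖v‖ := by
  have hrot : ∀ v w : Amb d, ‖v‖ = ‖w‖ → ∫ z : Sph d, |⟪(z : Amb d), v⟫| ∂(sigmaSph d) =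
      ∫ z : Sph d, |⟪(z : Amb d), w⟫| ∂(sigmaSph d) := by
    intro v w hvw
    obtain ⟨R, rfl⟩ := exists_isometry_map_eq hvw
    have h := integral_sigmaSph_comp_isometry R (fun z : Amb d => |⟪z, R v⟫|)
    simpa using h
  set e : Fin (d + 1) → Amb d := fun i => EuclideanSpace.single i (1 : ℝ) with he
  have he1 : ∀ i, ‖e i‖ = 1 := fun i => by simp [he]
  refine ⟨∫ z : Sph d, |⟪(z : Amb d), e 0⟫| ∂(sigmaSph d), ?_, fun v => ?_⟩
  · have hnn : 0 ≤ ∫ z : Sph d, |⟪(z : Amb d), e 0⟫| ∂(sigmaSph d) :=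
      integral_nonneg fun _ => abs_nonneg _
    refine hnn.lt_of_ne fun h0 => ?_
    have hint : ∀ i, Integrable (fun z : Sph d => |⟪(z : Amb d), e i⟫|) (sigmaSph d) := fun i =>
      Integrable.of_bound (C := 1) (by fun_prop) (.of_forall fun z => by
        simpa [he1] using abs_inner_sph_le z (e i))
    have hz : ∀ i, ∀ᵐ z : Sph d ∂(sigmaSph d), |⟪(z : Amb d), e i⟫| = 0 := fun i => by
      have : ∫ z : Sph d, |⟪(z : Amb d), e i⟫| ∂(sigmaSph d) = 0 := by
        rw [hrot (e i) (e 0) (by simp [he1]), ← h0]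
      exact (integral_eq_zero_iff_of_nonneg (fun _ => abs_nonneg _) (hint i)).1 this
    obtain ⟨z, hz⟩ := (ae_all_iff.2 hz).exists
    have : (z : Amb d) = 0 := by
      ext i
      simpa [he, EuclideanSpace.inner_single_right] using hz i
    have h1 : ‖(z : Amb d)‖ = 1 := by simp
    simp [this] at h1
  · have h := hrot v (‖v‖ • e 0) (by simp [norm_smul, he1])
    rw [h]
    simp [inner_smul_right, abs_mul, mul_comm ‖v‖, integral_mul_const]

/-- Spherical measure of a ball of radius `r` is `O(r^d)`. -/
lemma exists_sigmaSph_real_ball_le (d : ℕ) :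
    ∃ C : ℝ, 0 < C ∧ ∀ (r : ℝ), 0 < r → r < 1 → ∀ z : Amb d,
      (sigmaSph d).real {y : Sph d | ‖(y : Amb d) - z‖ ≤ r} ≤ C * r ^ d := by
  set V : ℝ := (volume : Measure (Amb d)).real (ball 0 1)
  set T : ℝ := (volume : Measure (Amb d)).toSphere.real Set.univ
  have hV : 0 < V := ENNReal.toReal_pos (measure_ball_pos _ _ one_pos).ne' measure_ball_lt_top.ne
  have hT : 0 < T := by
    have := (Measure.toSphere_real_apply_univ (volume : Measure (Amb d)))
    simp only [T, this]; simp; positivity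
  refine ⟨T⁻¹ * ((d + 1) * (2 ^ (d + 1) * V)), by positivity, fun r hr hr1 z => ?_⟩
  set s : Set (Sph d) := {y : Sph d | ‖(y : Amb d) - z‖ ≤ r} with hs
  have hsm : MeasurableSet s := measurableSet_le (by fun_prop) (by fun_prop)
  set K : Set (Amb d) := Set.Ioo (0 : ℝ) 1 • ((↑) '' s : Set (Amb d)) with hK
  have h1 : (sigmaSph d).real s = T⁻¹ * ((d + 1) * (volume : Measure (Amb d)).real K) := by
    simp [sigmaSph, Measure.real, Measure.toSphere_apply' _ hsm, T, ENNReal.toReal_mul, hK,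
      ENNReal.toReal_add]
  have hKb : K ⊆ ball 0 1 := by
    rintro _ ⟨t, ht, _, ⟨y, hy, rfl⟩, rfl⟩
    simp [norm_smul, abs_of_pos ht.1, ht.2]
  have hKfin : (volume : Measure (Amb d)) K ≠ ⊤ := measure_ne_top_of_subset hKb (by finiteness)
  have hcover : K ⊆ (1 - r) • K ∪ closedBall z (2 * r) := by
    rintro _ ⟨t, ht, _, ⟨y, hy, rfl⟩, rfl⟩
    by_cases h : t < 1 - r
    · left
      refine ⟨(t / (1 - r)) • (y : Amb d), ⟨t / (1 - r), ⟨div_pos ht.1 (by linarith), ?_⟩, _,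
        ⟨y, hy, rfl⟩, rfl⟩, ?_⟩
      · rw [div_lt_one (by linarith)]; exact h
      · simp only [smul_smul]
        rw [mul_div_cancel₀]; linarith
    · right
      have hy' : ‖(y : Amb d) - z‖ ≤ r := hy
      rw [mem_closedBall, dist_eq_norm]
      have e : t • (y : Amb d) - z = (t - 1) • (y : Amb d) + ((y : Amb d) - z) := by
        module
      simp only [e]
      refine (norm_add_le _ _).trans ?_
      rw [norm_smul]
      simp only [norm_eq_of_mem_sphere, mul_one, Real.norm_eq_abs]
      rw [abs_of_neg (by linarith [ht.2])]
      push Not at h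
      linarith
  have h2 : (volume : Measure (Amb d)).real K ≤
      (1 - r) ^ (d + 1) * (volume : Measure (Amb d)).real K + (2 * r) ^ (d + 1) * V := by
    have hb : (volume : Measure (Amb d)).real (closedBall z (2 * r)) = (2 * r) ^ (d + 1) * V := by
      rw [Measure.real, Measure.addHaar_closedBall _ _ (by positivity), ENNReal.toReal_mul,
        ENNReal.toReal_ofReal (by positivity)]
      simp [V, Measure.real]
    have hc : (volume : Measure (Amb d)).real ((1 - r) • K) =
        (1 - r) ^ (d + 1) * (volume : Measure (Amb d)).real K := by
      rw [Measure.real, Measure.addHaar_smul, ENNReal.toReal_mul,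
        ENNReal.toReal_ofReal (by positivity)]
      rw [abs_of_nonneg (pow_nonneg (by linarith) _)]
      simp [Measure.real]
    rw [← hb, ← hc]
    refine (measureReal_mono hcover ?_).trans (measureReal_union_le _ _)
    refine ((measure_mono (t := closedBall (0 : Amb d) 1 ∪ closedBall z (2 * r)) ?_).trans_lt
      ?_).ne
    · refine Set.union_subset_union_left _ ?_
      rintro _ ⟨v, hv, rfl⟩
      have := hKb hv
      simp only [mem_ball, dist_zero_right] at this
      simp only [mem_closedBall, dist_zero_right, norm_smul, Real.norm_eq_abs]
      rw [abs_of_pos (by linarith)]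
      nlinarith [norm_nonneg v]
    · exact ((isCompact_closedBall _ _).union (isCompact_closedBall _ _)).measure_lt_top
  have h3 : (1 - r) ^ (d + 1) ≤ 1 - r := by
    rw [pow_succ]
    exact mul_le_of_le_one_left (by linarith) (pow_le_one₀ (by linarith) (by linarith))
  have h4 : r * (volume : Measure (Amb d)).real K ≤ r * (r ^ d * (2 ^ (d + 1) * V)) := by
    have := mul_le_mul_of_nonneg_right h3
      (measureReal_nonneg (μ := (volume : Measure (Amb d))) (s := K))
    have e : (2 * r) ^ (d + 1) * V = r * (r ^ d * (2 ^ (d + 1) * V)) := by ring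
    linarith
  have h5 := le_of_mul_le_mul_left h4 hr
  rw [h1]
  calc _ ≤ T⁻¹ * ((d + 1) * (r ^ d * (2 ^ (d + 1) * V))) := by gcongr
    _ = _ := by ring

/-- For a signed density of total mass zero, the square of an integral is a combination of
squared differences. -/
lemma sq_integral_mul_eq_of_integral_eq_zero {Ω : Type*} [MeasurableSpace Ω] {P : Measure Ω}
    [IsFiniteMeasure P] {W k : Ω → ℝ} {A M : ℝ} (hW : Measurable W) (hWA : ∀ ω, |W ω| ≤ A)
    (hW0 : ∫ ω, W ω ∂P = 0) (hk : Measurable k) (hkM : ∀ ω, |k ω| ≤ M) :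
    (∫ ω, W ω * k ω ∂P) ^ 2 =
      -(1 / 2) * ∫ p, W p.1 * W p.2 * (k p.1 - k p.2) ^ 2 ∂(P.prod P) := by
  have iW : Integrable W P := .of_bound hW.aestronglyMeasurable A (.of_forall hWA)
  have iWk : Integrable (fun ω => W ω * k ω) P :=
    iW.mul_bdd (c := M) hk.aestronglyMeasurable (.of_forall hkM)
  have iWk2 : Integrable (fun ω => W ω * k ω ^ 2) P := by
    refine iW.mul_bdd (c := M ^ 2) (hk.pow_const 2).aestronglyMeasurable (.of_forall fun ω => ?_)
    rw [norm_pow]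
    exact pow_le_pow_left₀ (norm_nonneg _) (hkM ω) 2
  have e : ∀ p : Ω × Ω, W p.1 * W p.2 * (k p.1 - k p.2) ^ 2 =
      (W p.1 * k p.1 ^ 2) * W p.2 - 2 * ((W p.1 * k p.1) * (W p.2 * k p.2)) +
        W p.1 * (W p.2 * k p.2 ^ 2) := fun p => by ring
  simp_rw [e]
  rw [integral_add, integral_sub, integral_const_mul,
    integral_prod_mul (fun ω => W ω * k ω ^ 2) W, integral_prod_mul W (fun ω => W ω * k ω ^ 2),
    integral_prod_mul (fun ω => W ω * k ω) (fun ω => W ω * k ω), hW0]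
  · ring
  · exact iWk2.mul_prod iW
  · exact (iWk.mul_prod iWk).const_mul 2
  · exact (iWk2.mul_prod iW).sub ((iWk.mul_prod iWk).const_mul 2)
  · exact iW.mul_prod iWk2

lemma integral_sq_integral_mul_eq {Ω T : Type*} [MeasurableSpace Ω] [MeasurableSpace T]
    {P : Measure Ω} [IsFiniteMeasure P] {τ : Measure T} [SFinite τ] {W : Ω → ℝ} {A : ℝ}
    (hW : Measurable W) (hWA : ∀ ω, |W ω| ≤ A) (hW0 : ∫ ω, W ω ∂P = 0)
    {k : T → Ω → ℝ} (hk : Measurable (Function.uncurry k)) (hkM : ∀ t, ∃ M, ∀ ω, |k t ω| ≤ M)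
    (hint : ∀ ω ω', Integrable (fun t => (k t ω - k t ω') ^ 2) τ) {M : ℝ}
    (hM : ∀ ω ω', ∫ t, (k t ω - k t ω') ^ 2 ∂τ ≤ M) :
    Integrable (fun t => (∫ ω, W ω * k t ω ∂P) ^ 2) τ ∧
    ∫ t, (∫ ω, W ω * k t ω ∂P) ^ 2 ∂τ =
      -(1 / 2) * ∫ p, W p.1 * W p.2 * ∫ t, (k t p.1 - k t p.2) ^ 2 ∂τ ∂(P.prod P) := by
  have hpt : ∀ t, (∫ ω, W ω * k t ω ∂P) ^ 2 =
      -(1 / 2) * ∫ p, W p.1 * W p.2 * (k t p.1 - k t p.2) ^ 2 ∂(P.prod P) := fun t => by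
    obtain ⟨M, hM⟩ := hkM t
    exact sq_integral_mul_eq_of_integral_eq_zero hW hWA hW0 (hk.comp measurable_prodMk_left) hM
  have hmeas : Measurable (fun q : (Ω × Ω) × T =>
      W q.1.1 * W q.1.2 * (k q.2 q.1.1 - k q.2 q.1.2) ^ 2) := by
    have h1 : Measurable (fun q : (Ω × Ω) × T => k q.2 q.1.1) :=
      hk.comp (measurable_snd.prodMk measurable_fst.fst)
    have h2 : Measurable (fun q : (Ω × Ω) × T => k q.2 q.1.2) :=
      hk.comp (measurable_snd.prodMk measurable_fst.snd)
    fun_prop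
  have hI : Integrable (fun q : (Ω × Ω) × T =>
      W q.1.1 * W q.1.2 * (k q.2 q.1.1 - k q.2 q.1.2) ^ 2) ((P.prod P).prod τ) := by
    rw [integrable_prod_iff hmeas.aestronglyMeasurable]
    refine ⟨.of_forall fun p => (hint p.1 p.2).const_mul (W p.1 * W p.2), ?_⟩
    refine Integrable.of_bound (C := A * A * M)
      hmeas.aestronglyMeasurable.norm.integral_prod_right' (.of_forall fun p => ?_)
    simp only [norm_mul, Real.norm_eq_abs, integral_const_mul, abs_pow, sq_abs, abs_abs]
    rw [abs_of_nonneg (integral_nonneg fun t => sq_nonneg _)]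
    have hA : 0 ≤ A := (abs_nonneg _).trans (hWA p.1)
    exact mul_le_mul (mul_le_mul (hWA _) (hWA _) (abs_nonneg _) hA) (hM _ _)
      (integral_nonneg fun t => sq_nonneg _) (mul_nonneg hA hA)
  constructor
  · simp_rw [hpt]
    exact hI.integral_prod_right.const_mul _
  · simp_rw [hpt, integral_const_mul]
    rw [← integral_integral_swap (f := fun (p : Ω × Ω) t =>
      W p.1 * W p.2 * (k t p.1 - k t p.2) ^ 2) hI]
    simp_rw [integral_const_mul]

/-- The cone-shaped bump of radius `r` centred at `z`, evaluated at `x`. -/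
def coneBump {d : ℕ} (r : ℝ) (z x : Amb d) : ℝ := max 0 (r - ‖x - z‖)

lemma coneBump_nonneg {d : ℕ} (r : ℝ) (z x : Amb d) : 0 ≤ coneBump r z x := le_max_left _ _

lemma coneBump_le {d : ℕ} {r : ℝ} (hr : 0 ≤ r) (z x : Amb d) : coneBump r z x ≤ r :=
  max_le hr (by linarith [norm_nonneg (x - z)])

lemma coneBump_eq_zero {d : ℕ} {r : ℝ} {z x : Amb d} (h : r ≤ ‖x - z‖) : coneBump r z x = 0 :=
  max_eq_left (by linarith)

lemma continuous_coneBump {d : ℕ} :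
    Continuous fun p : ℝ × Amb d × Amb d => coneBump p.1 p.2.1 p.2.2 := by
  unfold coneBump; fun_prop

@[fun_prop]
lemma Measurable.coneBump {d : ℕ} {α : Type*} [MeasurableSpace α] {r : α → ℝ} {z x : α → Amb d}
    (hr : Measurable r) (hz : Measurable z) (hx : Measurable x) :
    Measurable fun a => coneBump (r a) (z a) (x a) :=
  continuous_coneBump.measurable.comp (hr.prodMk (hz.prodMk hx))

lemma abs_coneBump_sub_le {d : ℕ} (r : ℝ) (z x y : Amb d) :
    |coneBump r z x - coneBump r z y| ≤ ‖x - y‖ := by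
  unfold coneBump
  refine (abs_max_sub_max_le_max _ _ _ _).trans (max_le (by simp) ?_)
  rw [sub_sub_sub_cancel_left]
  refine (abs_norm_sub_norm_le _ _).trans ?_
  rw [sub_sub_sub_cancel_right, norm_sub_rev]

lemma one_add_sq_mul_coneBump_sub_sq_le {d : ℕ} {r : ℝ} (hr : 0 ≤ r) (z x y : Amb d) :
    (1 + r ^ 2) * (coneBump r z x - coneBump r z y) ^ 2 ≤ r ^ 2 * (1 + ‖x - y‖ ^ 2) *
      ((closedBall x r).indicator 1 z + (closedBall y r).indicator 1 z) := by
  have i0 : ∀ w : Amb d, (0 : ℝ) ≤ (closedBall w r).indicator 1 z := fun w =>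
    Set.indicator_nonneg (fun _ _ => zero_le_one) _
  by_cases h : z ∈ closedBall x r ∨ z ∈ closedBall y r
  · have h1 : (1 : ℝ) ≤ (closedBall x r).indicator 1 z + (closedBall y r).indicator 1 z := by
      rcases h with h | h
      · have := i0 y
        simp only [Set.indicator_of_mem h, Pi.one_apply]; linarith
      · have := i0 x
        simp only [Set.indicator_of_mem h, Pi.one_apply]; linarith
    have a1 : (coneBump r z x - coneBump r z y) ^ 2 ≤ r ^ 2 := by
      apply sq_le_sq'
      · linarith [coneBump_nonneg r z x, coneBump_le hr z y]
      · linarith [coneBump_nonneg r z y, coneBump_le hr z x]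
    have a2 : (coneBump r z x - coneBump r z y) ^ 2 ≤ ‖x - y‖ ^ 2 := by
      rw [← sq_abs]
      exact pow_le_pow_left₀ (abs_nonneg _) (abs_coneBump_sub_le r z x y) 2
    calc _ ≤ r ^ 2 * (1 + ‖x - y‖ ^ 2) := by
          have := mul_le_mul_of_nonneg_left a2 (sq_nonneg r)
          linarith
      _ ≤ _ := le_mul_of_one_le_right (by positivity) h1
  · push Not at h
    simp only [mem_closedBall, not_le, dist_eq_norm] at h
    rw [norm_sub_rev z x, norm_sub_rev z y] at h
    rw [coneBump_eq_zero h.1.le, coneBump_eq_zero h.2.le]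
    have := add_nonneg (i0 x) (i0 y)
    rw [sub_self, zero_pow two_ne_zero, mul_zero]
    exact mul_nonneg (by positivity) this

lemma real_volume_closedBall_amb {d : ℕ} (x : Amb d) {r : ℝ} (hr : 0 ≤ r) :
    (volume : Measure (Amb d)).real (closedBall x r) =
      r ^ (d + 1) * (volume : Measure (Amb d)).real (ball 0 1) := by
  rw [Measure.real, Measure.addHaar_closedBall _ _ hr, ENNReal.toReal_mul,
    ENNReal.toReal_ofReal (by positivity)]
  simp [Measure.real]

lemma integrable_indicator_closedBall_amb {d : ℕ} (x : Amb d) (r : ℝ) :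
    Integrable ((closedBall x r).indicator (1 : Amb d → ℝ)) :=
  (integrable_indicator_iff measurableSet_closedBall).2
    (integrableOn_const (isCompact_closedBall _ _).measure_lt_top.ne)

lemma integrable_coneBump_sub_sq {d : ℕ} (x y : Amb d) :
    Integrable (fun p : ℝ × Amb d =>
      (p.1 ^ (d + 3))⁻¹ * (coneBump p.1 p.2 x - coneBump p.1 p.2 y) ^ 2)
      ((volume.restrict (Set.Ioi 0)).prod volume) := by
  set V := (volume : Measure (Amb d)).real (ball 0 1)
  have hmeas : Measurable (fun p : ℝ × Amb d =>
      (p.1 ^ (d + 3))⁻¹ * (coneBump p.1 p.2 x - coneBump p.1 p.2 y) ^ 2) := by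
    fun_prop
  have hbd : ∀ r : ℝ, 0 < r → ∀ z : Amb d,
      ‖(r ^ (d + 3))⁻¹ * (coneBump r z x - coneBump r z y) ^ 2‖ ≤
        ((r ^ (d + 1))⁻¹ * (1 + ‖x - y‖ ^ 2) * (1 + r ^ 2)⁻¹) *
          ((closedBall x r).indicator 1 z + (closedBall y r).indicator 1 z) := by
    intro r hr z
    rw [Real.norm_of_nonneg (by positivity)]
    have h := one_add_sq_mul_coneBump_sub_sq_le hr.le z x y
    have h2 := mul_le_mul_of_nonneg_left h
      (show 0 ≤ (r ^ (d + 3))⁻¹ * (1 + r ^ 2)⁻¹ by positivity)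
    have hr2 : (1 + r ^ 2) ≠ 0 := by positivity
    have e : (r ^ (d + 3))⁻¹ * r ^ 2 = (r ^ (d + 1))⁻¹ := by field_simp; ring
    refine le_of_eq_of_le ?_ (h2.trans_eq ?_)
    · field_simp
    · rw [← e]; ring
  have hib : ∀ r : ℝ, Integrable (fun z : Amb d =>
      ((r ^ (d + 1))⁻¹ * (1 + ‖x - y‖ ^ 2) * (1 + r ^ 2)⁻¹) *
          ((closedBall x r).indicator 1 z + (closedBall y r).indicator 1 z)) := fun r =>
    ((integrable_indicator_closedBall_amb x r).add
      (integrable_indicator_closedBall_amb y r)).const_mul _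
  rw [integrable_prod_iff hmeas.aestronglyMeasurable]
  constructor
  · filter_upwards [ae_restrict_mem measurableSet_Ioi] with r hr
    exact (hib r).mono' (hmeas.comp measurable_prodMk_left).aestronglyMeasurable
      (.of_forall (hbd r hr))
  · refine Integrable.mono' (g := fun r => (2 * (1 + ‖x - y‖ ^ 2) * V) * (1 + r ^ 2)⁻¹)
      ((integrable_inv_one_add_sq.const_mul _).mono_measure Measure.restrict_le_self)
      hmeas.aestronglyMeasurable.norm.integral_prod_right' ?_
    filter_upwards [ae_restrict_mem measurableSet_Ioi] with r hr
    have hr' : 0 < r := hr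
    rw [Real.norm_of_nonneg (integral_nonneg fun _ => norm_nonneg _)]
    refine (integral_mono_of_nonneg (.of_forall fun _ => norm_nonneg _) (hib r)
      (.of_forall (hbd r hr))).trans (le_of_eq ?_)
    rw [integral_const_mul, integral_add (integrable_indicator_closedBall_amb x r)
      (integrable_indicator_closedBall_amb y r), integral_indicator_one measurableSet_closedBall,
      integral_indicator_one measurableSet_closedBall, real_volume_closedBall_amb x hr'.le,
      real_volume_closedBall_amb y hr'.le]
    have hr2 : (1 + r ^ 2) ≠ 0 := by positivity
    field_simp
    ring

/-- The bump energy of a pair of points is invariant under similarities, hence proportional to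
the distance. -/
lemma exists_integral_coneBump_sub_sq_eq (d : ℕ) :
    ∃ C : ℝ, 0 ≤ C ∧ ∀ x y : Amb d, ∫ p : ℝ × Amb d,
      (p.1 ^ (d + 3))⁻¹ * (coneBump p.1 p.2 x - coneBump p.1 p.2 y) ^ 2
      ∂((volume.restrict (Set.Ioi 0)).prod volume) = C * ‖x - y‖ := by
  set J : Amb d → ℝ := fun v => ∫ r in Set.Ioi (0 : ℝ), ∫ z : Amb d,
    (r ^ (d + 3))⁻¹ * (coneBump r z v - coneBump r z 0) ^ 2 with hJ
  have htrans : ∀ x y : Amb d, ∫ p : ℝ × Amb d,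
      (p.1 ^ (d + 3))⁻¹ * (coneBump p.1 p.2 x - coneBump p.1 p.2 y) ^ 2
      ∂((volume.restrict (Set.Ioi 0)).prod volume) = J (x - y) := by
    intro x y
    rw [integral_prod _ (integrable_coneBump_sub_sq x y), hJ]
    congr 1 with r
    rw [← integral_add_right_eq_self _ y]
    congr 1 with z
    simp only [coneBump, sub_add_eq_sub_sub_swap, zero_sub, sub_self]
  have hrot : ∀ v w : Amb d, ‖v‖ = ‖w‖ → J v = J w := by
    intro v w hvw
    obtain ⟨R, rfl⟩ := exists_isometry_map_eq hvw
    simp only [hJ]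
    congr 1 with r
    rw [← (LinearIsometryEquiv.measurePreserving R).integral_comp
      R.toHomeomorph.measurableEmbedding
      (fun z => (r ^ (d + 3))⁻¹ * (coneBump r z (R v) - coneBump r z 0) ^ 2)]
    congr 1 with z
    simp only [coneBump, ← map_sub, LinearIsometryEquiv.norm_map, zero_sub, norm_neg]
  have hscale : ∀ (s : ℝ) (v : Amb d), 0 < s → J (s • v) = s * J v := by
    intro s v hs
    simp only [hJ]
    have hb : ∀ (r : ℝ) (z u : Amb d), coneBump (s * r) (s • z) (s • u) = s * coneBump r z u := by
      intro r z u
      simp only [coneBump, ← smul_sub, norm_smul, Real.norm_of_nonneg hs.le, ← mul_sub]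
      rw [mul_max_of_nonneg _ _ hs.le, mul_zero]
    have h1 := integral_comp_mul_left_Ioi' (fun r => ∫ z : Amb d,
      (r ^ (d + 3))⁻¹ * (coneBump r z (s • v) - coneBump r z 0) ^ 2) 0 hs
    rw [mul_zero] at h1
    rw [← h1, smul_eq_mul]
    congr 1
    congr 1 with r
    have h2 := Measure.integral_comp_smul (volume : Measure (Amb d)) (fun z : Amb d =>
      ((s * r) ^ (d + 3))⁻¹ * (coneBump (s * r) z (s • v) - coneBump (s * r) z 0) ^ 2) s
    have hfin : Module.finrank ℝ (Amb d) = d + 1 := by simp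
    rw [hfin, abs_of_pos (by positivity), smul_eq_mul] at h2
    have h3 : ∫ z : Amb d, ((s * r) ^ (d + 3))⁻¹ *
          (coneBump (s * r) z (s • v) - coneBump (s * r) z 0) ^ 2 =
        s ^ (d + 1) * ∫ z : Amb d, ((s * r) ^ (d + 3))⁻¹ *
          (coneBump (s * r) (s • z) (s • v) - coneBump (s * r) (s • z) 0) ^ 2 := by
      rw [h2]; field_simp
    rw [h3, ← integral_const_mul]
    congr 1 with z
    have h0 : coneBump (s * r) (s • z) 0 = s * coneBump r z 0 := by
      rw [← hb, smul_zero]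
    rw [hb, h0, mul_pow, mul_inv]
    field_simp
    ring
  set e : Amb d := EuclideanSpace.single 0 (1 : ℝ) with he
  have he1 : ‖e‖ = 1 := by simp [he]
  refine ⟨J e, ?_, fun x y => ?_⟩
  · refine setIntegral_nonneg measurableSet_Ioi fun r hr => integral_nonneg fun z => ?_
    have : (0 : ℝ) < r := hr
    simp only [Pi.zero_apply]
    positivity
  · rw [htrans]
    rcases eq_or_ne (x - y) 0 with h | h
    · simp [h, hJ]
    · rw [hrot (x - y) (‖x - y‖ • e) (by simp [norm_smul, he1]), hscale _ _ (norm_pos_iff.2 h),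
        mul_comm]

/-- The average of the bump `coneBump r z` over the sphere. -/
def coneAvg {d : ℕ} (r : ℝ) (z : Amb d) : ℝ := ∫ y : Sph d, coneBump r z y ∂(sigmaSph d)

lemma integrable_coneBump_sigmaSph {d : ℕ} {r : ℝ} (hr : 0 ≤ r) (z : Amb d) :
    Integrable (fun y : Sph d => coneBump r z y) (sigmaSph d) :=
  .of_bound (Measurable.aestronglyMeasurable (by fun_prop)) r (.of_forall fun y => by
    rw [Real.norm_of_nonneg (coneBump_nonneg _ _ _)]
    exact coneBump_le hr _ _)

lemma integrable_coneBump {d : ℕ} {r : ℝ} (hr : 0 ≤ r) (x : Amb d) :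
    Integrable (fun z : Amb d => coneBump r z x) := by
  refine ((integrable_indicator_closedBall_amb x r).const_mul r).mono'
    (Measurable.aestronglyMeasurable (by fun_prop)) (.of_forall fun z => ?_)
  rw [Real.norm_of_nonneg (coneBump_nonneg _ _ _)]
  by_cases h : z ∈ closedBall x r
  · simpa [h] using coneBump_le hr z x
  · rw [coneBump_eq_zero]
    · simp [h]
    · rw [norm_sub_rev, ← dist_eq_norm]
      exact (not_le.1 h).le

lemma coneAvg_nonneg {d : ℕ} (r : ℝ) (z : Amb d) : 0 ≤ coneAvg r z :=
  integral_nonneg fun _ => coneBump_nonneg _ _ _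

lemma coneAvg_le {d : ℕ} {r : ℝ} (hr : 0 ≤ r) (z : Amb d) :
    coneAvg r z ≤ r * (sigmaSph d).real {y : Sph d | ‖(y : Amb d) - z‖ ≤ r} := by
  have hm : MeasurableSet {y : Sph d | ‖(y : Amb d) - z‖ ≤ r} :=
    measurableSet_le (by fun_prop) (by fun_prop)
  rw [← integral_indicator_one hm, ← integral_const_mul]
  refine integral_mono (integrable_coneBump_sigmaSph hr z)
    (((integrable_indicator_iff hm).2 (integrableOn_const (measure_ne_top _ _))).const_mul r)
    fun y => ?_
  by_cases h : ‖(y : Amb d) - z‖ ≤ r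
  · simpa [h] using coneBump_le hr z y
  · simp [h, coneBump_eq_zero (not_le.1 h).le]

lemma coneAvg_eq_zero {d : ℕ} {r : ℝ} {z : Amb d} (h : r ≤ |1 - ‖z‖|) : coneAvg r z = 0 := by
  refine integral_eq_zero_of_ae (.of_forall fun y => coneBump_eq_zero (h.trans ?_))
  have := abs_norm_sub_norm_le (y : Amb d) z
  simpa using this

lemma integrable_coneBump_prod {d : ℕ} {r : ℝ} (hr : 0 ≤ r) :
    Integrable (fun p : Sph d × Amb d => coneBump r p.2 p.1) ((sigmaSph d).prod volume) := by
  refine ((integrable_indicator_closedBall_amb 0 (1 + r)).const_mul r).comp_snd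
    (sigmaSph d) |>.mono' (Measurable.aestronglyMeasurable (by fun_prop))
    (.of_forall fun ⟨y, z⟩ => ?_)
  rw [Real.norm_of_nonneg (coneBump_nonneg _ _ _)]
  by_cases h : z ∈ closedBall 0 (1 + r)
  · simpa [h] using coneBump_le hr z y
  · dsimp only
    rw [coneBump_eq_zero]
    · simp [h]
    · have h1 : 1 + r < ‖z‖ := by simpa using h
      have h2 := norm_sub_norm_le z y
      rw [norm_sub_rev] at h2
      simp only [norm_eq_of_mem_sphere] at h2
      linarith

lemma integrable_coneAvg {d : ℕ} {r : ℝ} (hr : 0 ≤ r) : Integrable (coneAvg (d := d) r) :=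
  (integrable_coneBump_prod hr).integral_prod_right

lemma le_integral_coneBump {d : ℕ} {r : ℝ} (hr : 0 ≤ r) (x : Amb d) :
    (r / 2) ^ (d + 2) * (volume : Measure (Amb d)).real (ball 0 1) ≤
      ∫ z : Amb d, coneBump r z x := by
  have h := real_volume_closedBall_amb x (show 0 ≤ r / 2 by positivity)
  rw [← integral_indicator_one measurableSet_closedBall] at h
  rw [pow_succ' (r / 2) (d + 1), mul_assoc, ← h, ← integral_const_mul]
  refine integral_mono ((integrable_indicator_closedBall_amb x _).const_mul _)
    (integrable_coneBump hr x) fun z => ?_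
  by_cases hz : z ∈ closedBall x (r / 2)
  · have : ‖x - z‖ ≤ r / 2 := by rwa [norm_sub_rev, ← dist_eq_norm]
    simp only [hz, Set.indicator_of_mem, Pi.one_apply, mul_one]
    exact le_max_of_le_right (by linarith)
  · simpa [hz] using coneBump_nonneg r z x

lemma le_integral_coneAvg {d : ℕ} {r : ℝ} (hr : 0 ≤ r) :
    (r / 2) ^ (d + 2) * (volume : Measure (Amb d)).real (ball 0 1) ≤
      ∫ z : Amb d, coneAvg r z := by
  have h := integral_integral_swap (f := fun (y : Sph d) (z : Amb d) => coneBump r z y)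
    (integrable_coneBump_prod hr)
  unfold coneAvg
  rw [← h]
  have := integral_mono (μ := sigmaSph d) (integrable_const _)
    (integrable_coneBump_prod hr).integral_prod_left
    (fun y : Sph d => le_integral_coneBump hr (y : Amb d))
  simpa using this

lemma one_add_pow_sub_one_sub_pow_le {r : ℝ} (hr : 0 ≤ r) (hr1 : r ≤ 1) (m : ℕ) :
    (1 + r) ^ m - (1 - r) ^ m ≤ (2 ^ m + m) * r := by
  have h1 : 1 - m * r ≤ (1 - r) ^ m := by
    have := one_add_mul_le_pow (a := -r) (by linarith) m
    simpa [sub_eq_add_neg] using this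
  have h2 : (1 + r) ^ m ≤ 1 + (2 ^ m - 1) * r := by
    clear h1
    induction m with
    | zero => simp
    | succ m ih =>
      have h4 : (1 : ℝ) ≤ 2 ^ m := one_le_pow₀ (by norm_num)
      calc (1 + r) ^ (m + 1) ≤ (1 + (2 ^ m - 1) * r) * (1 + r) := by
            rw [pow_succ]
            exact mul_le_mul_of_nonneg_right ih (by linarith)
        _ ≤ 1 + (2 ^ (m + 1) - 1) * r := by
            rw [pow_succ]
            nlinarith [mul_nonneg (mul_nonneg (sub_nonneg.2 h4) hr) (sub_nonneg.2 hr1)]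
  linarith

lemma real_volume_shell_le {d : ℕ} {r : ℝ} (hr : 0 ≤ r) (hr1 : r ≤ 1) :
    (volume : Measure (Amb d)).real (closedBall 0 (1 + r) \ closedBall 0 (1 - r)) ≤
      (2 ^ (d + 1) + (d + 1 : ℕ)) * (volume : Measure (Amb d)).real (ball 0 1) * r := by
  rw [measureReal_sdiff (closedBall_subset_closedBall (by linarith)) measurableSet_closedBall
    (isCompact_closedBall _ _).measure_lt_top.ne, real_volume_closedBall_amb 0 (by linarith),
    real_volume_closedBall_amb 0 (by linarith), ← sub_mul]
  have := mul_le_mul_of_nonneg_right (one_add_pow_sub_one_sub_pow_le hr hr1 (d + 1))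
    (measureReal_nonneg (μ := (volume : Measure (Amb d))) (s := ball 0 1))
  linarith

/-- At scales where balls around the nodes cover little of the sphere, the bump transform of
`∑ w_j δ_{x_j} - σ` has large `L²` norm, whatever the weights. -/
lemma exists_le_integral_sq_bump (d : ℕ) :
    ∃ ε κ : ℝ, 0 < ε ∧ 0 < κ ∧ ∀ (N : ℕ) (x : Fin N → Sph d) (w : Fin N → ℝ) (r : ℝ),
      0 < r → r < 1 → N * r ^ d ≤ ε →
        κ * r ^ (2 * d + 3) ≤ ∫ z : Amb d, (∑ j, w j * coneBump r z (x j) - coneAvg r z) ^ 2 := by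
  obtain ⟨Cσ, hCσ, hσ⟩ := exists_sigmaSph_real_ball_le d
  set V : ℝ := (volume : Measure (Amb d)).real (ball 0 1)
  have hV : 0 < V := ENNReal.toReal_pos (measure_ball_pos _ _ one_pos).ne' measure_ball_lt_top.ne
  set S : ℝ := (2 ^ (d + 1) + (d + 1 : ℕ)) * V with hS
  have hSpos : 0 < S := by positivity
  set β : ℝ := (1 / 2) ^ (d + 2) * V with hβ
  have hβpos : 0 < β := by positivity
  refine ⟨β / (2 * Cσ * V), β ^ 2 / (4 * S), by positivity, by positivity, ?_⟩
  intro N x w r hr hr1 hN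
  set g : Amb d → ℝ := coneAvg r with hg
  set M : ℝ := Cσ * r ^ (d + 1) with hM
  set l : ℝ := β * r ^ (d + 1) / (2 * S) with hl
  have hl0 : 0 < l := by positivity
  have hgM : ∀ z, g z ≤ M := fun z => by
    refine (coneAvg_le hr.le z).trans ((mul_le_mul_of_nonneg_left (hσ r hr hr1 z) hr.le).trans
      (le_of_eq ?_))
    rw [hM]; ring
  have hg0 : ∀ z, 0 ≤ g z := coneAvg_nonneg r
  set sh : Set (Amb d) := closedBall 0 (1 + r) \ closedBall 0 (1 - r) with hsh
  have hshm : MeasurableSet sh := measurableSet_closedBall.diff measurableSet_closedBall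
  have hgsh : ∀ z, z ∉ sh → g z = 0 := fun z hz => by
    apply coneAvg_eq_zero
    simp only [hsh, Set.mem_sdiff, mem_closedBall, dist_zero_right, not_and, not_not] at hz
    by_cases h : ‖z‖ ≤ 1 + r
    · exact le_abs.2 (Or.inl (by linarith [hz h]))
    · exact le_abs.2 (Or.inr (by linarith))
  have hishell : Integrable (sh.indicator (1 : Amb d → ℝ)) :=
    (integrable_indicator_iff hshm).2 (integrableOn_const
      ((measure_mono Set.sdiff_subset).trans_lt (isCompact_closedBall _ _).measure_lt_top).ne)
  have hiballs : Integrable (fun z : Amb d =>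
      ∑ j, (closedBall (x j : Amb d) r).indicator (1 : Amb d → ℝ) z) :=
    integrable_finsetSum _ fun j _ => integrable_indicator_closedBall_amb _ _
  have hib : Integrable (fun z : Amb d => ∑ j, w j * coneBump r z (x j) - g z) :=
    (integrable_finsetSum _ fun j _ => (integrable_coneBump hr.le _).const_mul _).sub
      (integrable_coneAvg hr.le)
  have hib2 : Integrable (fun z : Amb d => (∑ j, w j * coneBump r z (x j) - g z) ^ 2) := by
    simp_rw [pow_two]
    refine hib.mul_bdd (c := ∑ j, |w j| * r + M) hib.aestronglyMeasurable (.of_forall fun z => ?_)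
    refine (norm_sub_le _ _).trans (add_le_add ((norm_sum_le _ _).trans
      (Finset.sum_le_sum fun j _ => ?_)) ?_)
    · rw [norm_mul, Real.norm_of_nonneg (coneBump_nonneg _ _ _)]
      exact mul_le_mul_of_nonneg_left (coneBump_le hr.le _ _) (norm_nonneg _)
    · rw [Real.norm_of_nonneg (hg0 z)]; exact hgM z
  have hpt : ∀ z : Amb d,
      2 * l * (g z - M * ∑ j, (closedBall (x j : Amb d) r).indicator (1 : Amb d → ℝ) z) -
        l ^ 2 * sh.indicator 1 z ≤ (∑ j, w j * coneBump r z (x j) - g z) ^ 2 := by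
    intro z
    have hi0 : ∀ j, (0 : ℝ) ≤ (closedBall (x j : Amb d) r).indicator (1 : Amb d → ℝ) z := fun j =>
      Set.indicator_nonneg (fun _ _ => zero_le_one) _
    have hs0 : (0 : ℝ) ≤ sh.indicator 1 z := Set.indicator_nonneg (fun _ _ => zero_le_one) _
    have hM0 : 0 ≤ M := (hg0 z).trans (hgM z)
    by_cases h : ∃ j, z ∈ closedBall (x j : Amb d) r
    · obtain ⟨j, hj⟩ := h
      have h1 : (1 : ℝ) ≤ ∑ j, (closedBall (x j : Amb d) r).indicator (1 : Amb d → ℝ) z := by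
        have := Finset.single_le_sum (fun j _ => hi0 j) (Finset.mem_univ j)
        simpa [hj] using this
      have h2 : g z - M * ∑ j, (closedBall (x j : Amb d) r).indicator (1 : Amb d → ℝ) z ≤ 0 := by
        have := mul_le_mul_of_nonneg_left h1 hM0
        linarith [hgM z]
      have h3 := mul_nonneg (sq_nonneg l) hs0
      have h4 := mul_nonneg (show 0 ≤ 2 * l by positivity) (neg_nonneg.2 h2)
      linarith [sq_nonneg (∑ j, w j * coneBump r z (x j) - g z)]
    · push Not at h
      have e1 : ∑ j, w j * coneBump r z (x j) = 0 := Finset.sum_eq_zero fun j _ => by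
        rw [coneBump_eq_zero, mul_zero]
        rw [norm_sub_rev, ← dist_eq_norm]
        exact (not_le.1 (h j)).le
      have e2 : ∑ j, (closedBall (x j : Amb d) r).indicator (1 : Amb d → ℝ) z = 0 :=
        Finset.sum_eq_zero fun j _ => by simp only [h j, not_false_eq_true, Set.indicator_of_notMem]
      rw [e1, e2]
      by_cases hz : z ∈ sh
      · simp only [hz, Set.indicator_of_mem, Pi.one_apply]
        nlinarith [sq_nonneg (g z - l)]
      · simp [hz, hgsh z hz]
  have hia : Integrable (fun z : Amb d => 2 * l * (g z - M *
      ∑ j, (closedBall (x j : Amb d) r).indicator (1 : Amb d → ℝ) z)) :=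
    ((integrable_coneAvg hr.le).sub (hiballs.const_mul M)).const_mul (2 * l)
  refine le_trans ?_ (integral_mono (hia.sub (hishell.const_mul (l ^ 2))) hib2 hpt)
  rw [integral_sub' hia (hishell.const_mul (l ^ 2)), integral_const_mul, integral_const_mul,
    integral_sub (integrable_coneAvg hr.le) (hiballs.const_mul M), integral_const_mul,
    integral_finsetSum _ fun j _ => integrable_indicator_closedBall_amb _ _,
    integral_indicator_one hshm]
  simp_rw [integral_indicator_one measurableSet_closedBall,
    real_volume_closedBall_amb _ hr.le]
  have a1 := real_volume_shell_le (d := d) hr.le hr1.le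
  have a2 := le_integral_coneAvg (d := d) hr.le
  have a3 : M * ∑ j : Fin N, r ^ (d + 1) * V ≤ β / 2 * r ^ (d + 2) := by
    simp only [Finset.sum_const, Finset.card_univ, Fintype.card_fin, nsmul_eq_mul]
    calc _ = (N * r ^ d) * (Cσ * V * r ^ (d + 2)) := by rw [hM]; ring
      _ ≤ β / (2 * Cσ * V) * (Cσ * V * r ^ (d + 2)) := by gcongr
      _ = _ := by field_simp
  have a4 : β * r ^ (d + 2) ≤ ∫ z, g z := by
    refine le_trans (le_of_eq ?_) a2
    rw [hβ, div_pow, div_pow]; ring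
  have a5 := mul_le_mul_of_nonneg_left a1 (sq_nonneg l)
  have a6 := mul_le_mul_of_nonneg_left (sub_le_sub a4 a3) (show 0 ≤ 2 * l by positivity)
  have a7 : β ^ 2 / (4 * S) * r ^ (2 * d + 3) =
      2 * l * (β * r ^ (d + 2) - β / 2 * r ^ (d + 2)) - l ^ 2 * (S * r) := by
    rw [hl]; field_simp; ring
  rw [a7]
  linarith

/-- The index space carrying both the nodes and the uniform measure. -/
def nodeMeasure (N d : ℕ) : Measure (Fin N ⊕ Sph d) :=
  Measure.map Sum.inl Measure.count + Measure.map Sum.inr (sigmaSph d)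

instance (N d : ℕ) : IsFiniteMeasure (nodeMeasure N d) := by
  unfold nodeMeasure; infer_instance

lemma integral_nodeMeasure {N d : ℕ} {f : Fin N ⊕ Sph d → ℝ}
    (hr : Integrable (fun y => f (.inr y)) (sigmaSph d)) :
    ∫ ω, f ω ∂(nodeMeasure N d) = ∑ j, f (.inl j) + ∫ y, f (.inr y) ∂(sigmaSph d) := by
  have e1 : MeasurableEmbedding (Sum.inl : Fin N → Fin N ⊕ Sph d) :=
    ⟨Sum.inl_injective, measurable_inl, fun _ hs => hs.inl_image⟩
  have e2 : MeasurableEmbedding (Sum.inr : Sph d → Fin N ⊕ Sph d) :=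
    ⟨Sum.inr_injective, measurable_inr, fun _ hs => measurableSet_inr_image.2 hs⟩
  rw [nodeMeasure, integral_add_measure, e1.integral_map, e2.integral_map]
  · congr 1
    simp [integral_fintype]
  · exact e1.integrable_map_iff.2 (.of_finite)
  · exact e2.integrable_map_iff.2 hr

/-- The indicator function of a spherical cap as a kernel in `(t, z)` and `y`. -/
def capInd {d : ℕ} (p : ℝ × Sph d) (y : Sph d) : ℝ := (sphCap p.2 p.1).indicator (fun _ => 1) y

/-- The local discrepancy at the cap indexed by `p = (t, z)`. -/
def capDisc {d N : ℕ} (x : Fin N → Sph d) (w : Fin N → ℝ) (p : ℝ × Sph d) : ℝ :=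
  ∑ j, w j * capInd p (x j) - ∫ y, capInd p y ∂(sigmaSph d)

/-- The measure on the parameter space of spherical caps. -/
abbrev capMeasure (d : ℕ) : Measure (ℝ × Sph d) :=
  (volume.restrict (Set.Icc (-1 : ℝ) 1)).prod (sigmaSph d)

lemma capInd_eq {d : ℕ} (p : ℝ × Sph d) (y : Sph d) :
    capInd p y = (Set.Iic ⟪(p.2 : Amb d), (y : Amb d)⟫).indicator 1 p.1 := by
  simp [capInd, sphCap, Set.indicator_apply]

lemma measurable_capInd {d : ℕ} : Measurable (Function.uncurry (capInd (d := d))) := by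
  have hs : MeasurableSet {q : (ℝ × Sph d) × Sph d | q.1.1 ≤ ⟪(q.1.2 : Amb d), (q.2 : Amb d)⟫} :=
    measurableSet_le (by fun_prop) (by fun_prop)
  exact measurable_const.indicator hs (f := fun _ => (1 : ℝ))

lemma capInd_nonneg {d : ℕ} (p : ℝ × Sph d) (y : Sph d) : 0 ≤ capInd p y :=
  Set.indicator_nonneg (fun _ _ => zero_le_one) _

lemma capInd_le_one {d : ℕ} (p : ℝ × Sph d) (y : Sph d) : capInd p y ≤ 1 :=
  Set.indicator_le_self' (fun _ _ => zero_le_one) y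

lemma norm_capInd_le {d : ℕ} (p : ℝ × Sph d) (y : Sph d) : ‖capInd p y‖ ≤ 1 := by
  rw [Real.norm_of_nonneg (capInd_nonneg p y)]
  exact capInd_le_one p y

lemma integrable_capInd {d : ℕ} (y : Sph d) : Integrable (fun p => capInd p y) (capMeasure d) :=
  .of_bound (measurable_capInd.comp measurable_prodMk_right).aestronglyMeasurable 1
    (.of_forall fun p => norm_capInd_le p y)

lemma integral_capInd_sphere {d : ℕ} (p : ℝ × Sph d) :
    ∫ y, capInd p y ∂(sigmaSph d) = ((sigmaSph d) (sphCap p.2 p.1)).toReal :=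
  integral_indicator_one (measurableSet_le (by fun_prop) (by fun_prop))

lemma inner_sph_mem_Icc {d : ℕ} (z y : Sph d) :
    ⟪(z : Amb d), (y : Amb d)⟫ ∈ Set.Icc (-1 : ℝ) 1 := by
  have := abs_inner_sph_le z (y : Amb d)
  rw [norm_eq_of_mem_sphere, abs_le] at this
  exact this

lemma integral_capInd {d : ℕ} (y : Sph d) : ∫ p, capInd p y ∂(capMeasure d) = 1 := by
  rw [integral_prod_symm _ (integrable_capInd y)]
  have h : ∀ z : Sph d, ∫ t in Set.Icc (-1 : ℝ) 1, capInd (t, z) y =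
      ⟪(z : Amb d), (y : Amb d)⟫ + 1 := by
    intro z
    have hz := inner_sph_mem_Icc z y
    simp_rw [capInd_eq]
    rw [integral_indicator_one measurableSet_Iic, measureReal_restrict_apply measurableSet_Iic,
      show Set.Iic ⟪(z : Amb d), (y : Amb d)⟫ ∩ Set.Icc (-1) 1 = Set.Icc (-1) _ from
        Set.ext fun t => ⟨fun h => ⟨h.2.1, h.1⟩, fun h => ⟨h.2, h.1, h.2.trans hz.2⟩⟩,
      Real.volume_real_Icc_of_le hz.1]
    ring
  simp_rw [h]
  rw [integral_add _ (integrable_const _), integral_inner_sigmaSph]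
  · simp
  · exact .of_bound (by fun_prop) 1 (.of_forall fun z => by
      simpa using abs_inner_sph_le z (y : Amb d))

lemma integrable_capInd_sub_sq {d : ℕ} (x y : Sph d) :
    Integrable (fun p => (capInd p x - capInd p y) ^ 2) (capMeasure d) := by
  refine .of_bound (((integrable_capInd x).sub (integrable_capInd y)).aestronglyMeasurable.pow 2) 1
    (.of_forall fun p => ?_)
  rw [norm_pow]
  refine pow_le_one₀ (norm_nonneg _) ?_
  rw [Real.norm_eq_abs, abs_le]
  constructor <;>
    linarith [capInd_nonneg p x, capInd_nonneg p y, capInd_le_one p x, capInd_le_one p y]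

lemma integral_capInd_sub_sq {d : ℕ} (x y : Sph d) :
    ∫ p, (capInd p x - capInd p y) ^ 2 ∂(capMeasure d) =
      ∫ z : Sph d, |⟪(z : Amb d), (x : Amb d) - y⟫| ∂(sigmaSph d) := by
  rw [integral_prod_symm _ (integrable_capInd_sub_sq x y)]
  congr 1 with z
  have hx := inner_sph_mem_Icc z x
  have hy := inner_sph_mem_Icc z y
  simp_rw [capInd_eq, inner_sub_right]
  generalize ⟪(z : Amb d), (x : Amb d)⟫ = a at *
  generalize ⟪(z : Amb d), (y : Amb d)⟫ = b at *
  have e : ∀ t : ℝ, ((Set.Iic a).indicator 1 t - (Set.Iic b).indicator 1 t) ^ 2 =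
      (Set.uIoc a b).indicator (1 : ℝ → ℝ) t := by
    intro t
    have h : t ∈ Set.uIoc a b ↔ ¬(t ≤ a ↔ t ≤ b) := by
      rw [Set.mem_uIoc]; grind
    by_cases h1 : t ≤ a <;> by_cases h2 : t ≤ b <;>
      simp [Set.indicator, h, h1, h2]
  simp_rw [e]
  rw [integral_indicator_one measurableSet_uIoc, measureReal_restrict_apply measurableSet_uIoc,
    Set.inter_eq_left.2]
  · simp [Measure.real, Real.volume_uIoc, abs_sub_comm]
  · exact fun t ht => ⟨(le_min hx.1 hy.1).trans ht.1.le, ht.2.trans (max_le hx.2 hy.2)⟩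

lemma measurable_capDisc {d N : ℕ} (x : Fin N → Sph d) (w : Fin N → ℝ) :
    Measurable (capDisc x w) := by
  refine Measurable.sub (Finset.measurable_fun_sum _ fun j _ =>
    (measurable_capInd.comp measurable_prodMk_right).const_mul _) ?_
  exact (measurable_capInd (d := d)).stronglyMeasurable.integral_prod_right'.measurable

lemma abs_capDisc_le {d N : ℕ} (x : Fin N → Sph d) (w : Fin N → ℝ) (p : ℝ × Sph d) :
    |capDisc x w p| ≤ ∑ j, |w j| + 1 := by
  refine (abs_sub _ _).trans (add_le_add ((Finset.abs_sum_le_sum_abs _ _).trans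
    (Finset.sum_le_sum fun j _ => ?_)) ?_)
  · rw [abs_mul]
    exact mul_le_of_le_one_right (abs_nonneg _) (norm_capInd_le p _)
  · simpa using norm_integral_le_of_norm_le_const (μ := sigmaSph d)
      (.of_forall fun y => norm_capInd_le p y)

lemma integrable_capDisc {d N : ℕ} (x : Fin N → Sph d) (w : Fin N → ℝ) :
    Integrable (capDisc x w) (capMeasure d) :=
  .of_bound (measurable_capDisc x w).aestronglyMeasurable _ (.of_forall (abs_capDisc_le x w))

lemma integrable_capDisc_sq {d N : ℕ} (x : Fin N → Sph d) (w : Fin N → ℝ) :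
    Integrable (fun p => capDisc x w p ^ 2) (capMeasure d) := by
  simp_rw [pow_two]
  exact (integrable_capDisc x w).mul_bdd (integrable_capDisc x w).aestronglyMeasurable
    (.of_forall (abs_capDisc_le x w))

lemma sphDisc_eq_sqrt {d N : ℕ} (x : Fin N → Sph d) (w : Fin N → ℝ) :
    sphDisc x w = √(∫ p, capDisc x w p ^ 2 ∂(capMeasure d)) := by
  rw [integral_prod _ (integrable_capDisc_sq x w)]
  simp only [capDisc, integral_capInd_sphere]
  rfl

lemma integral_capDisc {d N : ℕ} (x : Fin N → Sph d) (w : Fin N → ℝ) :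
    ∫ p, capDisc x w p ∂(capMeasure d) = ∑ j, w j - 1 := by
  have hi : Integrable (Function.uncurry (capInd (d := d))) ((capMeasure d).prod (sigmaSph d)) :=
    .of_bound measurable_capInd.aestronglyMeasurable 1 (.of_forall fun q => norm_capInd_le q.1 q.2)
  have hl : Integrable (fun p => ∫ y, capInd p y ∂(sigmaSph d)) (capMeasure d) :=
    hi.integral_prod_left
  unfold capDisc
  rw [integral_sub (integrable_finsetSum _ fun j _ => (integrable_capInd _).const_mul _) hl,
    integral_finsetSum _ fun j _ => (integrable_capInd _).const_mul _, integral_integral_swap hi]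
  simp [integral_const_mul, integral_capInd]

lemma real_capMeasure_univ (d : ℕ) : (capMeasure d).real Set.univ = 2 := by
  rw [← Set.univ_prod_univ, measureReal_prod_prod]
  simp
  norm_num

lemma sq_sum_sub_one_le {d N : ℕ} (x : Fin N → Sph d) (w : Fin N → ℝ) :
    (∑ j, w j - 1) ^ 2 ≤ 2 * ∫ p, capDisc x w p ^ 2 ∂(capMeasure d) := by
  set a := ∑ j, w j - 1 with ha
  have h : 0 ≤ ∫ p, (capDisc x w p ^ 2 - a * capDisc x w p + a ^ 2 / 4) ∂(capMeasure d) := by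
    refine integral_nonneg fun p => ?_
    have : 0 ≤ (capDisc x w p - a / 2) ^ 2 := sq_nonneg _
    simp only [Pi.zero_apply]
    linarith
  have hi : Integrable (fun p => capDisc x w p ^ 2 - a * capDisc x w p) (capMeasure d) :=
    (integrable_capDisc_sq x w).sub ((integrable_capDisc x w).const_mul a)
  rw [integral_add hi (integrable_const _), integral_sub (integrable_capDisc_sq x w)
    ((integrable_capDisc x w).const_mul a), integral_const_mul, integral_capDisc, ← ha] at h
  rw [integral_const, real_capMeasure_univ, smul_eq_mul] at h
  linarith

/-- The energy of the signed measure `∑ w_j δ_{x_j} - σ_d` for the Euclidean distance. -/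
def nodeEnergy {d N : ℕ} (x : Fin N → Sph d) (w : Fin N → ℝ) : ℝ :=
  -(1 / 2) * ∫ p, Sum.elim w (fun _ => -1) p.1 * Sum.elim w (fun _ => -1) p.2 *
    ‖((Sum.elim x id p.1 : Sph d) : Amb d) - (Sum.elim x id p.2 : Sph d)‖
      ∂((nodeMeasure N d).prod (nodeMeasure N d))

lemma integral_sq_sum_sub_integral_eq {d N : ℕ} {T : Type*} [MeasurableSpace T] {τ : Measure T}
    [SFinite τ] (x : Fin N → Sph d) {w : Fin N → ℝ} (hw : ∑ j, w j = 1) {k : T → Sph d → ℝ}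
    (hk : Measurable (Function.uncurry k)) (hkM : ∀ t, ∃ M, ∀ y, |k t y| ≤ M)
    (hint : ∀ y y', Integrable (fun t => (k t y - k t y') ^ 2) τ) {c : ℝ} (hc : 0 ≤ c)
    (hkc : ∀ y y' : Sph d, ∫ t, (k t y - k t y') ^ 2 ∂τ = c * ‖(y : Amb d) - y'‖) :
    Integrable (fun t => (∑ j, w j * k t (x j) - ∫ y, k t y ∂(sigmaSph d)) ^ 2) τ ∧
    ∫ t, (∑ j, w j * k t (x j) - ∫ y, k t y ∂(sigmaSph d)) ^ 2 ∂τ = c * nodeEnergy x w := by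
  set W : Fin N ⊕ Sph d → ℝ := Sum.elim w (fun _ => -1) with hWdef
  set X : Fin N ⊕ Sph d → Sph d := Sum.elim x id with hXdef
  have hW : Measurable W := (measurable_of_finite w).sumElim measurable_const
  have hX : Measurable X := (measurable_of_finite x).sumElim measurable_id
  have hWA : ∀ ω, |W ω| ≤ ∑ j, |w j| + 1 := by
    rintro (j | y)
    · exact (Finset.single_le_sum (f := fun j => |w j|) (fun _ _ => abs_nonneg _)
        (Finset.mem_univ j)).trans (by linarith)
    · simpa [hWdef] using Finset.sum_nonneg fun j _ => abs_nonneg (w j)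
  have hW0 : ∫ ω, W ω ∂(nodeMeasure N d) = 0 := by
    rw [integral_nodeMeasure (by simp [hWdef])]
    simp [hWdef, hw]
  have hWk : ∀ t, ∫ ω, W ω * k t (X ω) ∂(nodeMeasure N d) =
      ∑ j, w j * k t (x j) - ∫ y, k t y ∂(sigmaSph d) := by
    intro t
    obtain ⟨M, hM⟩ := hkM t
    have hi : Integrable (k t) (sigmaSph d) :=
      .of_bound (hk.comp measurable_prodMk_left).aestronglyMeasurable M (.of_forall hM)
    rw [integral_nodeMeasure (by simpa [hWdef, hXdef] using hi.neg)]
    simp [hWdef, hXdef, integral_neg, sub_eq_add_neg]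
  obtain ⟨h1, h2⟩ := integral_sq_integral_mul_eq (P := nodeMeasure N d) (τ := τ) hW hWA hW0
    (k := fun t ω => k t (X ω)) (hk.comp (measurable_fst.prodMk (hX.comp measurable_snd)))
    (fun t => (hkM t).imp fun M hM ω => hM _) (fun ω ω' => hint _ _) (M := c * 2)
    (fun ω ω' => by
      rw [hkc]
      refine mul_le_mul_of_nonneg_left ((norm_sub_le _ _).trans ?_) hc
      simp only [norm_eq_of_mem_sphere]
      norm_num)
  simp_rw [hWk] at h1 h2
  refine ⟨h1, h2.trans ?_⟩
  simp_rw [hkc, mul_left_comm _ c]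
  rw [integral_const_mul, mul_left_comm, nodeEnergy]

/-- Parameters `(r, z)` of the bumps `coneBump r z`. -/
abbrev bumpMeasure (d : ℕ) : Measure (ℝ × Amb d) := (volume.restrict (Set.Ioi 0)).prod volume

lemma exists_mul_integral_sq_bump_le (d : ℕ) : ∃ a : ℝ, 0 < a ∧
    ∀ (N : ℕ) (x : Fin N → Sph d) (w : Fin N → ℝ), ∑ j, w j = 1 →
      Integrable (fun p : ℝ × Amb d => (p.1 ^ (d + 3))⁻¹ *
        (∑ j, w j * coneBump p.1 p.2 (x j) - coneAvg p.1 p.2) ^ 2) (bumpMeasure d) ∧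
      a * ∫ p, (p.1 ^ (d + 3))⁻¹ *
        (∑ j, w j * coneBump p.1 p.2 (x j) - coneAvg p.1 p.2) ^ 2 ∂(bumpMeasure d) ≤
      ∫ p, capDisc x w p ^ 2 ∂(capMeasure d) := by
  obtain ⟨c, hc, hcap⟩ := exists_integral_abs_inner_eq d
  obtain ⟨C, hC, hbump⟩ := exists_integral_coneBump_sub_sq_eq d
  refine ⟨c / (C + 1), by positivity, fun N x w hw => ?_⟩
  have h1 := (integral_sq_sum_sub_integral_eq (τ := capMeasure d) x hw measurable_capInd
    (fun p => ⟨1, norm_capInd_le p⟩) integrable_capInd_sub_sq hc.le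
    (fun y y' => by rw [integral_capInd_sub_sq, hcap])).2
  set k : ℝ × Amb d → Sph d → ℝ := fun p y => √((p.1 ^ (d + 3))⁻¹) * coneBump p.1 p.2 y with hk
  have hae : ∀ᵐ p ∂(bumpMeasure d), √((p.1 ^ (d + 3))⁻¹) ^ 2 = (p.1 ^ (d + 3))⁻¹ := by
    have : ∀ᵐ r : ℝ ∂(volume.restrict (Set.Ioi 0)), √((r ^ (d + 3))⁻¹) ^ 2 = (r ^ (d + 3))⁻¹ := by
      filter_upwards [ae_restrict_mem measurableSet_Ioi] with r hr
      have : (0 : ℝ) < r := hr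
      exact Real.sq_sqrt (by positivity)
    exact Measure.quasiMeasurePreserving_fst.ae this
  have hdiff : ∀ y y' : Sph d, (fun p => (k p y - k p y') ^ 2) =ᵐ[bumpMeasure d] fun p =>
      (p.1 ^ (d + 3))⁻¹ * (coneBump p.1 p.2 y - coneBump p.1 p.2 y') ^ 2 := fun y y' => by
    filter_upwards [hae] with p hp
    rw [hk, ← mul_sub, mul_pow, hp]
  have hsum : (fun p => (∑ j, w j * k p (x j) - ∫ y, k p y ∂(sigmaSph d)) ^ 2)
      =ᵐ[bumpMeasure d] fun p => (p.1 ^ (d + 3))⁻¹ *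
        (∑ j, w j * coneBump p.1 p.2 (x j) - coneAvg p.1 p.2) ^ 2 := by
    filter_upwards [hae] with p hp
    rw [← hp, ← mul_pow, mul_sub, Finset.mul_sum, coneAvg, ← integral_const_mul]
    simp only [hk, mul_left_comm]
  obtain ⟨h2, h3⟩ := integral_sq_sum_sub_integral_eq (τ := bumpMeasure d) x hw (k := k)
    (by simp only [hk, Function.uncurry_def]; fun_prop)
    (fun p => ⟨√((p.1 ^ (d + 3))⁻¹) * |p.1|, fun y => by
      rw [abs_mul, abs_of_nonneg (Real.sqrt_nonneg _), abs_of_nonneg (coneBump_nonneg _ _ _)]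
      exact mul_le_mul_of_nonneg_left (max_le (abs_nonneg _)
        (by linarith [le_abs_self p.1, norm_nonneg ((y : Amb d) - p.2)])) (Real.sqrt_nonneg _)⟩)
    (fun y y' => (integrable_coneBump_sub_sq _ _).congr (hdiff y y').symm) hC
    (fun y y' => by rw [integral_congr_ae (hdiff y y'), hbump])
  refine ⟨h2.congr hsum, ?_⟩
  rw [← integral_congr_ae hsum, h3]
  have hQ : 0 ≤ c * nodeEnergy x w := h1 ▸ integral_nonneg fun _ => sq_nonneg _
  refine le_trans ?_ h1.ge
  rw [div_mul_eq_mul_div, div_le_iff₀ (by positivity)]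
  nlinarith

lemma exists_le_integral_capDisc_sq_of_sum_eq_one (d : ℕ) (hd : 0 < d) : ∃ c : ℝ, 0 < c ∧
    ∀ (N : ℕ), 0 < N → ∀ (x : Fin N → Sph d) (w : Fin N → ℝ), ∑ j, w j = 1 →
      c * (N : ℝ) ^ (-(1 : ℝ) - 1 / d) ≤ ∫ p, capDisc x w p ^ 2 ∂(capMeasure d) := by
  obtain ⟨ε, κ, hε, hκ, hlow⟩ := exists_le_integral_sq_bump d
  obtain ⟨a, ha, hcmp⟩ := exists_mul_integral_sq_bump_le d
  have hd' : (0 : ℝ) < d := by exact_mod_cast hd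
  set η : ℝ := min (1 / 4) (ε ^ (1 / d : ℝ) / 2) with hη
  have hη0 : 0 < η := lt_min (by norm_num) (by positivity)
  refine ⟨a * κ * η ^ (d + 1), by positivity, fun N hN x w hw => ?_⟩
  have hN1 : (1 : ℝ) ≤ N := by exact_mod_cast hN
  have hN0 : (0 : ℝ) < N := by linarith
  obtain ⟨hint, hle⟩ := hcmp N x w hw
  set ρ : ℝ := η * (N : ℝ) ^ (-(1 / d) : ℝ) with hρ
  have hρ0 : 0 < ρ := by positivity
  have hρ1 : 2 * ρ < 1 := by
    have h1 : (N : ℝ) ^ (-(1 / d) : ℝ) ≤ 1 :=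
      Real.rpow_le_one_of_one_le_of_nonpos hN1 (by simp)
    have h2 : η ≤ 1 / 4 := min_le_left _ _
    have h3 : ρ ≤ η := mul_le_of_le_one_right hη0.le h1
    linarith
  have hNr : N * (2 * ρ) ^ d ≤ ε := by
    have h1 : (2 * η) ^ d ≤ ε := by
      have h2 : 2 * η ≤ ε ^ (1 / d : ℝ) := by linarith [min_le_right (1 / 4) (ε ^ (1 / d : ℝ) / 2)]
      refine (pow_le_pow_left₀ (by positivity) h2 d).trans_eq ?_
      rw [one_div, Real.rpow_inv_natCast_pow hε.le hd.ne']
    have h2 : ((N : ℝ) ^ (-(1 / d) : ℝ)) ^ d = (N : ℝ)⁻¹ := by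
      rw [Real.rpow_neg hN0.le, inv_pow, one_div, Real.rpow_inv_natCast_pow hN0.le hd.ne']
    rw [hρ, ← mul_assoc, mul_pow, h2, mul_comm, mul_assoc, inv_mul_cancel₀ hN0.ne', mul_one]
    exact h1
  have hρpow : ρ ^ (d + 1) = η ^ (d + 1) * (N : ℝ) ^ (-(1 : ℝ) - 1 / d) := by
    rw [hρ, mul_pow, ← Real.rpow_natCast ((N : ℝ) ^ _) (d + 1), ← Real.rpow_mul hN0.le]
    congr 2
    push_cast
    field_simp
    ring
  refine le_trans ?_ hle
  rw [mul_assoc, mul_assoc, ← hρpow]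
  refine mul_le_mul_of_nonneg_left ?_ ha.le
  rw [integral_prod _ hint]
  have hsub : Set.Ioc ρ (2 * ρ) ⊆ Set.Ioi 0 := fun r hr => hρ0.trans hr.1
  have hintr := hint.integral_prod_left
  calc κ * ρ ^ (d + 1) = ∫ _ in Set.Ioc ρ (2 * ρ), κ * ρ ^ d := by
        rw [setIntegral_const, Real.volume_real_Ioc_of_le (by linarith), smul_eq_mul]
        ring
    _ ≤ ∫ r in Set.Ioc ρ (2 * ρ), ∫ z : Amb d, (r ^ (d + 3))⁻¹ *
        (∑ j, w j * coneBump r z (x j) - coneAvg r z) ^ 2 := by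
      refine setIntegral_mono_on (integrableOn_const (by simp)) (IntegrableOn.mono_set hintr hsub)
        measurableSet_Ioc fun r hr => ?_
      have hr0 : 0 < r := hsub hr
      rw [integral_const_mul]
      have h := hlow N x w r hr0 (hr.2.trans_lt hρ1) (le_trans (by gcongr; exact hr.2) hNr)
      calc κ * ρ ^ d ≤ κ * r ^ d := by gcongr; exact hr.1.le
        _ = (r ^ (d + 3))⁻¹ * (κ * r ^ (2 * d + 3)) := by
          rw [show 2 * d + 3 = (d + 3) + d by ring, pow_add r (d + 3)]
          field_simp
        _ ≤ _ := by gcongr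
    _ ≤ _ := by
      refine setIntegral_mono_set hintr ?_ hsub.eventuallyLE
      filter_upwards [ae_restrict_mem measurableSet_Ioi] with r hr
      have : (0 : ℝ) < r := hr
      exact integral_nonneg fun z => by positivity

lemma exists_le_integral_capDisc_sq (d : ℕ) (hd : 0 < d) : ∃ c : ℝ, 0 < c ∧
    ∀ (n : ℕ), 0 < n → ∀ (x : Fin n → Sph d) (w : Fin n → ℝ),
      c * (n : ℝ) ^ (-(1 : ℝ) - 1 / d) ≤ ∫ p, capDisc x w p ^ 2 ∂(capMeasure d) := by
  obtain ⟨c, hc, h⟩ := exists_le_integral_capDisc_sq_of_sum_eq_one d hd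
  refine ⟨c / 10 * 2 ^ (-(1 : ℝ) - 1 / d), by positivity, fun n hn x w => ?_⟩
  have hn' : (1 : ℝ) ≤ n := by exact_mod_cast hn
  set a := ∑ j, w j - 1 with ha
  set x' : Fin (n + 1) → Sph d := Fin.cons (x ⟨0, hn⟩) x with hx'
  set w' : Fin (n + 1) → ℝ := Fin.cons (-a) w with hw'
  have hsum : ∑ j, w' j = 1 := by
    rw [Fin.sum_univ_succ]
    simp [hw', ha]
  have hdisc : ∀ p, capDisc x' w' p = capDisc x w p - a * capInd p (x ⟨0, hn⟩) := fun p => by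
    unfold capDisc
    rw [Fin.sum_univ_succ]
    simp only [hx', hw', Fin.cons_zero, Fin.cons_succ]
    ring
  have hpt : ∀ p, capDisc x' w' p ^ 2 ≤ 2 * capDisc x w p ^ 2 + 2 * a ^ 2 := fun p => by
    have h1 : (a * capInd p (x ⟨0, hn⟩)) ^ 2 ≤ a ^ 2 := by
      rw [mul_pow]
      exact mul_le_of_le_one_right (sq_nonneg _)
        (pow_le_one₀ (capInd_nonneg _ _) (capInd_le_one _ _))
    rw [hdisc]
    nlinarith [sq_nonneg (capDisc x w p + a * capInd p (x ⟨0, hn⟩))]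
  have hle : ∫ p, capDisc x' w' p ^ 2 ∂(capMeasure d) ≤
      10 * ∫ p, capDisc x w p ^ 2 ∂(capMeasure d) := by
    have h1 := integral_mono (integrable_capDisc_sq x' w')
      (((integrable_capDisc_sq x w).const_mul 2).add (integrable_const (2 * a ^ 2))) hpt
    have h2 := integral_add ((integrable_capDisc_sq x w).const_mul 2)
      (integrable_const (μ := capMeasure d) (2 * a ^ 2))
    rw [integral_const_mul, integral_const, real_capMeasure_univ, smul_eq_mul] at h2
    have h3 := sq_sum_sub_one_le x w
    refine h1.trans (h2.le.trans ?_)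
    linarith
  have hpow : (2 : ℝ) ^ (-(1 : ℝ) - 1 / d) * (n : ℝ) ^ (-(1 : ℝ) - 1 / d) ≤
      ((n + 1 : ℕ) : ℝ) ^ (-(1 : ℝ) - 1 / d) := by
    rw [← Real.mul_rpow (by norm_num) (by linarith)]
    refine Real.rpow_le_rpow_of_nonpos (by positivity) (by push_cast; linarith) ?_
    have : (0 : ℝ) ≤ 1 / d := by positivity
    linarith
  have h4 := (mul_le_mul_of_nonneg_left hpow hc.le).trans (h (n + 1) n.succ_pos x' w' hsum)
  linarith

/-- the weighted spherical `L_2`-discrepancy of any `n` points with any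
weights is at least `c · n^{-1/2 - 1/(2d)}`. -/
theorem weighted_discrepancy_lower_bound (d : ℕ) (hd : 0 < d) :
    ∃ c : ℝ, 0 < c ∧
      ∀ (n : ℕ), 0 < n → ∀ (x : Fin n → Sph d) (w : Fin n → ℝ),
        c * (n : ℝ) ^ (-(1 : ℝ) / 2 - 1 / (2 * d)) ≤ sphDisc x w := by
  obtain ⟨c, hc, h⟩ := exists_le_integral_capDisc_sq d hd
  refine ⟨√c, Real.sqrt_pos.2 hc, fun n hn x w => ?_⟩
  have hpow : √((n : ℝ) ^ (-(1 : ℝ) - 1 / d)) = (n : ℝ) ^ (-(1 : ℝ) / 2 - 1 / (2 * d)) := by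
    rw [Real.sqrt_eq_rpow, ← Real.rpow_mul n.cast_nonneg]
    congr 1
    field_simp
  rw [sphDisc_eq_sqrt, ← hpow, ← Real.sqrt_mul hc.le]
  exact Real.sqrt_le_sqrt (h n hn x w)

end
end

section
/- Let d be a positive integer, 1 < p < ∞, and let s be a positive integer with s > d/p; let p* = p/(p−1) be the Hölder conjugate of p. Let δ > 0 and B = B(0,δ) ⊂ ℝ^d be the open Euclidean ball of radius δ. Then there exists a constant c > 0 such that for every nonempty finite point set P ⊂ B and every choice of weights (w_x)_{x∈P} ∈ ℝ^P, there exists an infinitely differentiable function f: ℝ^d → ℝ with support contained in B and Sobolev norm ( Σ_{k=0}^{s} ‖ x ↦ ‖D^k f(x)‖ ‖_{L_p(ℝ^d)}^p )^{1/p} at most 1 such that | ∫_B f(x) dx − Σ_{x∈P} w_x f(x) | ≥ c·‖dist(·, P)‖_{L_{s p*}(B)}^{s}. -/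
open MeasureTheory Metric

/-- Pointwise bounds for a sum of functions with disjoint supports give an `L^p` bound. -/
theorem integral_norm_sum_rpow_le {α ι G : Type*} [MeasurableSpace α] {μ : Measure α}
    [NormedAddCommGroup G] {u : Finset ι} {A : ι → Set α} {g : ι → α → G} {C : ι → ℝ} {p : ℝ}
    (hp : 0 < p) (hA : (u : Set ι).PairwiseDisjoint A) (hAm : ∀ b ∈ u, MeasurableSet (A b))
    (hAf : ∀ b ∈ u, μ (A b) ≠ ⊤) (hC : ∀ b ∈ u, 0 ≤ C b)
    (hg : ∀ b ∈ u, ∀ x ∉ A b, g b x = 0) (hgC : ∀ b ∈ u, ∀ x, ‖g b x‖ ≤ C b) :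
    ∫ x, ‖∑ b ∈ u, g b x‖ ^ p ∂μ ≤ ∑ b ∈ u, C b ^ p * μ.real (A b) := by
  have hint : ∀ b ∈ u, Integrable ((A b).indicator fun _ => C b ^ p) μ := fun b hb =>
    (integrable_indicator_iff (hAm b hb)).2 (integrableOn_const (hAf b hb))
  have hsum : ∫ x, ∑ b ∈ u, (A b).indicator (fun _ => C b ^ p) x ∂μ =
      ∑ b ∈ u, C b ^ p * μ.real (A b) := by
    rw [integral_finsetSum _ hint]
    refine Finset.sum_congr rfl fun b hb => ?_
    rw [integral_indicator_const _ (hAm b hb), smul_eq_mul, mul_comm]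
  rw [← hsum]
  refine integral_mono_of_nonneg (.of_forall fun x => by positivity)
    (integrable_finsetSum _ hint) (.of_forall fun x => ?_)
  have hnonneg : ∀ b ∈ u, 0 ≤ (A b).indicator (fun _ => C b ^ p) x := fun b hb =>
    Set.indicator_nonneg (fun _ _ => Real.rpow_nonneg (hC b hb) p) x
  by_cases hx : ∃ b ∈ u, x ∈ A b
  · obtain ⟨b, hb, hxb⟩ := hx
    have h1 : ∑ b ∈ u, g b x = g b x :=
      Finset.sum_eq_single_of_mem b hb fun b' hb' hne =>
        hg b' hb' x fun hx' => Set.disjoint_left.1 (hA hb' hb hne) hx' hxb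
    calc ‖∑ b ∈ u, g b x‖ ^ p ≤ C b ^ p := by
          rw [h1]; exact Real.rpow_le_rpow (norm_nonneg _) (hgC b hb x) hp.le
      _ = (A b).indicator (fun _ => C b ^ p) x := by rw [Set.indicator_of_mem hxb]
      _ ≤ _ := Finset.single_le_sum hnonneg hb
  · push Not at hx
    have h1 : ∑ b ∈ u, g b x = 0 := Finset.sum_eq_zero fun b hb => hg b hb x (hx b hb)
    simpa [h1, Real.zero_rpow hp.ne'] using Finset.sum_nonneg hnonneg

section Rescaling

variable {E : Type*} [NormedAddCommGroup E] [NormedSpace ℝ E]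

theorem norm_iteratedFDeriv_comp_inv_smul_sub {φ : E → ℝ} {k : ℕ} (hφ : ContDiff ℝ k φ)
    (y : E) {r : ℝ} (hr : 0 < r) (x : E) :
    ‖iteratedFDeriv ℝ k (fun x => φ (r⁻¹ • (x - y))) x‖ =
      (r ^ k)⁻¹ * ‖iteratedFDeriv ℝ k φ (r⁻¹ • (x - y))‖ := by
  rw [iteratedFDeriv_comp_sub (f := fun x => φ (r⁻¹ • x)), iteratedFDeriv_comp_const_smul _ hφ]
  simp [norm_smul, abs_of_pos hr]

theorem exists_bound_iteratedFDeriv {φ : E → ℝ} (hφ : ContDiff ℝ (⊤ : ℕ∞) φ)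
    (hφc : HasCompactSupport φ) (s : ℕ) :
    ∃ M : ℝ, 0 < M ∧ ∀ k ≤ s, ∀ x, ‖iteratedFDeriv ℝ k φ x‖ ≤ M := by
  have h : ∀ k, ∃ C, ∀ x, ‖iteratedFDeriv ℝ k φ x‖ ≤ C := fun k =>
    (hφc.iteratedFDeriv k).exists_bound_of_continuous
      (hφ.continuous_iteratedFDeriv (mod_cast le_top))
  choose C hC using h
  refine ⟨∑ k ∈ Finset.range (s + 1), |C k| + 1, by positivity, fun k hk x => ?_⟩
  have := Finset.single_le_sum (f := fun k => |C k|) (fun i _ => abs_nonneg (C i))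
    (Finset.mem_range.2 (Nat.lt_succ_of_le hk))
  linarith [hC k x, le_abs_self (C k)]

theorem integral_comp_inv_smul_sub [MeasurableSpace E] [BorelSpace E] [FiniteDimensional ℝ E]
    (μ : Measure E) [μ.IsAddHaarMeasure] (φ : E → ℝ) (y : E) {r : ℝ} (hr : 0 < r) :
    ∫ x, φ (r⁻¹ • (x - y)) ∂μ = r ^ Module.finrank ℝ E * ∫ x, φ x ∂μ := by
  rw [integral_sub_right_eq_self (fun x => φ (r⁻¹ • x)),
    Measure.integral_comp_inv_smul_of_nonneg _ _ hr.le, smul_eq_mul]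

end Rescaling

/-- A Vitali-type selection: the part of the ball which stays away from `P` is covered by
enlargements of finitely many disjoint balls that avoid `P`, lie in the ball and have radii
comparable to the distance to `P`. -/
theorem exists_disjoint_balls_avoiding {E : Type*} [NormedAddCommGroup E] [NormedSpace ℝ E]
    [ProperSpace E] {P : Set E} {δ ε : ℝ} (hδ : 0 < δ) (hε : 0 < ε) (hP : P.Nonempty)
    (hPδ : P ⊆ ball 0 δ) :
    ∃ (u : Finset E) (y : E → E) (ρ : E → ℝ),
      (∀ b ∈ u, 0 < ρ b ∧ ρ b ≤ δ ∧ ball (y b) (ρ b) ⊆ ball 0 δ ∧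
        Disjoint (ball (y b) (ρ b)) P) ∧
      (u : Set E).PairwiseDisjoint (fun b => closedBall (y b) (ρ b)) ∧
      ∀ x ∈ closedBall (0 : E) δ, ε ≤ infDist x P →
        ∃ b ∈ u, x ∈ closedBall (y b) (10 * ρ b) ∧ infDist x P ≤ 20 * ρ b := by
  classical
  set ρ : E → ℝ := fun x => infDist x P / 4 with hρ
  set y : E → E := fun x => (1 - ρ x / δ) • x with hy
  set K : Set E := closedBall 0 δ ∩ {x | ε ≤ infDist x P}
  have hKc : IsCompact K := (isCompact_closedBall _ _).inter_right
    (isClosed_le continuous_const (continuous_infDist_pt P))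
  have hρpos : ∀ x ∈ K, 0 < ρ x := fun x hx => by
    have : ε ≤ infDist x P := hx.2
    simp only [hρ]; linarith
  have hρδ : ∀ x ∈ K, ρ x ≤ δ := fun x hx => by
    obtain ⟨q, hq⟩ := hP
    have h1 := infDist_le_dist_of_mem (x := x) hq
    have h2 : dist q 0 < δ := hPδ hq
    have h3 : dist x 0 ≤ δ := hx.1
    simp only [hρ]; linarith [dist_triangle_right x q 0]
  have hyx : ∀ x ∈ K, dist (y x) x ≤ ρ x := fun x hx => by
    have h3 : ‖x‖ ≤ δ := by simpa using hx.1
    have : y x - x = -((ρ x / δ) • x) := by simp only [hy]; module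
    rw [dist_eq_norm, this, norm_neg, norm_smul, Real.norm_of_nonneg
      (div_nonneg (hρpos x hx).le hδ.le), div_mul_eq_mul_div, div_le_iff₀ hδ]
    exact mul_le_mul_of_nonneg_left h3 (hρpos x hx).le
  have hyn : ∀ x ∈ K, dist (y x) 0 + ρ x ≤ δ := fun x hx => by
    have h3 : ‖x‖ ≤ δ := by simpa using hx.1
    have h4 : 0 ≤ 1 - ρ x / δ := by
      rw [sub_nonneg, div_le_one hδ]; exact hρδ x hx
    have h5 := mul_le_mul_of_nonneg_left h3 h4
    have h6 : (1 - ρ x / δ) * δ = δ - ρ x := by field_simp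
    rw [dist_zero_right, hy, norm_smul, Real.norm_of_nonneg h4]
    linarith
  obtain ⟨t, htK, hcov⟩ := hKc.elim_nhds_subcover (fun x => closedBall (y x) (2 * ρ x))
    fun x hx => Filter.mem_of_superset (ball_mem_nhds x (hρpos x hx)) fun z hz => by
      have h1 : dist z x < ρ x := hz
      have := hyx x hx
      rw [mem_closedBall]
      linarith [dist_triangle_right z (y x) x]
  obtain ⟨v, hvt, hdisj, henl⟩ := Vitali.exists_disjoint_subfamily_covering_enlargement_closedBall
    (t : Set E) y (fun x => 2 * ρ x) (2 * δ) (fun a ha => by linarith [hρδ a (htK a ha)]) 5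
    (by norm_num)
  have hvfin : v.Finite := t.finite_toSet.subset hvt
  have hvK : ∀ b ∈ v, b ∈ K := fun b hb => htK b (hvt hb)
  refine ⟨hvfin.toFinset, y, ρ, fun b hb => ?_, ?_, fun x hx hxε => ?_⟩
  · rw [hvfin.mem_toFinset] at hb
    have hbK := hvK b hb
    refine ⟨hρpos b hbK, hρδ b hbK, ball_subset_ball' (by linarith [hyn b hbK]), ?_⟩
    refine (disjoint_ball_infDist (x := b)).mono_left (ball_subset_ball' ?_)
    have := hyx b hbK
    have := hρpos b hbK
    have : infDist b P = 4 * ρ b := by simp only [hρ]; ring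
    linarith
  · rw [hvfin.coe_toFinset]
    exact fun a ha b hb hab => (hdisj ha hb hab).mono
      (closedBall_subset_closedBall (by linarith [hρpos a (hvK a ha)]))
      (closedBall_subset_closedBall (by linarith [hρpos b (hvK b hb)]))
  · obtain ⟨a, hat, hxa⟩ := Set.mem_iUnion₂.1 (hcov ⟨hx, hxε⟩)
    obtain ⟨b, hbv, hab⟩ := henl a hat
    have hxb : x ∈ closedBall (y b) (10 * ρ b) := by
      have := hab hxa
      rwa [show 5 * (2 * ρ b) = 10 * ρ b by ring] at this
    refine ⟨b, hvfin.mem_toFinset.2 hbv, hxb, ?_⟩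
    have h1 : dist x (y b) ≤ 10 * ρ b := hxb
    have h2 := hyx b (hvK b hbv)
    have h3 := infDist_le_infDist_add_dist (s := P) (x := x) (y := b)
    have h4 : infDist b P = 4 * ρ b := by simp only [hρ]; ring
    have := hρpos b (hvK b hbv)
    linarith [dist_triangle x (y b) b]

section FoolingFunction

variable {E : Type*} [NormedAddCommGroup E] [NormedSpace ℝ E] [FiniteDimensional ℝ E]
  [MeasurableSpace E] [BorelSpace E] (μ : Measure E) [μ.IsAddHaarMeasure]

/-- The `a`-th moment of the distance to `P` is controlled by disjoint balls that avoid `P`. -/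
theorem exists_disjoint_balls_setIntegral_infDist_rpow_le {δ a : ℝ} (hδ : 0 < δ) (ha : 0 < a) :
    ∃ C : ℝ, 0 < C ∧ ∀ P : Set E, P.Nonempty → P ⊆ ball 0 δ →
      0 < ∫ x in ball 0 δ, infDist x P ^ a ∂μ →
      ∃ (u : Finset E) (y : E → E) (ρ : E → ℝ),
        (∀ b ∈ u, 0 < ρ b ∧ ρ b ≤ δ ∧ ball (y b) (ρ b) ⊆ ball 0 δ ∧
          Disjoint (ball (y b) (ρ b)) P) ∧
        (u : Set E).PairwiseDisjoint (fun b => closedBall (y b) (ρ b)) ∧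
        ∫ x in ball 0 δ, infDist x P ^ a ∂μ ≤
          C * ∑ b ∈ u, ρ b ^ a * ρ b ^ Module.finrank ℝ E := by
  have : ProperSpace E := FiniteDimensional.proper_real E
  set n := Module.finrank ℝ E
  set ω := μ.real (ball (0 : E) 1)
  have hω : 0 < ω :=
    ENNReal.toReal_pos (measure_ball_pos μ 0 one_pos).ne' measure_ball_lt_top.ne
  have hV : 0 < μ.real (ball (0 : E) δ) :=
    ENNReal.toReal_pos (measure_ball_pos μ 0 hδ).ne' measure_ball_lt_top.ne
  refine ⟨2 * (20 ^ a * 10 ^ n * ω), by positivity, fun P hP hPδ hI => ?_⟩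
  set I := ∫ x in ball 0 δ, infDist x P ^ a ∂μ
  set ε := (I / (2 * μ.real (ball (0 : E) δ))) ^ a⁻¹
  have hεpos : 0 < ε := by positivity
  have hεa : ε ^ a = I / (2 * μ.real (ball (0 : E) δ)) :=
    Real.rpow_inv_rpow (by positivity) ha.ne'
  obtain ⟨u, y, ρ, hu, hdisj, hcov⟩ := exists_disjoint_balls_avoiding hδ hεpos hP hPδ
  refine ⟨u, y, ρ, hu, hdisj, ?_⟩
  have hint : ∀ b ∈ u, Integrable ((closedBall (y b) (10 * ρ b)).indicator
      fun _ => (20 * ρ b) ^ a) (μ.restrict (ball 0 δ)) := fun b _ =>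
    ((integrable_indicator_iff measurableSet_closedBall).2
      (integrableOn_const measure_closedBall_lt_top.ne)).restrict
  have hconst : Integrable (fun _ : E => ε ^ a) (μ.restrict (ball 0 δ)) :=
    integrableOn_const measure_ball_lt_top.ne
  have hbound : I ≤ ∫ x in ball 0 δ, (ε ^ a + ∑ b ∈ u,
      (closedBall (y b) (10 * ρ b)).indicator (fun _ => (20 * ρ b) ^ a) x) ∂μ := by
    refine integral_mono_of_nonneg
      (.of_forall fun x => Real.rpow_nonneg infDist_nonneg a)
      (hconst.add (integrable_finsetSum _ hint))
      ((ae_restrict_mem measurableSet_ball).mono fun x hx => ?_)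
    have hnonneg : ∀ b ∈ u, 0 ≤ (closedBall (y b) (10 * ρ b)).indicator
        (fun _ => (20 * ρ b) ^ a) x := fun b hb =>
      Set.indicator_nonneg (fun _ _ => Real.rpow_nonneg (by linarith [(hu b hb).1]) a) x
    dsimp only
    rcases le_or_gt ε (infDist x P) with h | h
    · obtain ⟨b, hb, hxb, hle⟩ := hcov x (ball_subset_closedBall hx) h
      have h1 := Finset.single_le_sum hnonneg hb
      rw [Set.indicator_of_mem hxb] at h1
      have h2 := Real.rpow_le_rpow infDist_nonneg hle ha.le
      have h3 : 0 ≤ ε ^ a := by positivity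
      linarith
    · have h2 := Real.rpow_le_rpow infDist_nonneg h.le ha.le
      linarith [Finset.sum_nonneg hnonneg]
  rw [integral_add hconst (integrable_finsetSum _ hint), integral_finsetSum _ hint,
    setIntegral_const, smul_eq_mul, hεa] at hbound
  have hhalf : μ.real (ball (0 : E) δ) * (I / (2 * μ.real (ball (0 : E) δ))) = I / 2 := by
    field_simp
  have hterm : ∀ b ∈ u, ∫ x in ball 0 δ, (closedBall (y b) (10 * ρ b)).indicator
      (fun _ => (20 * ρ b) ^ a) x ∂μ ≤ 20 ^ a * 10 ^ n * ω * (ρ b ^ a * ρ b ^ n) := by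
    intro b hb
    have hb0 := (hu b hb).1
    rw [integral_indicator_const _ measurableSet_closedBall, smul_eq_mul]
    calc _ ≤ μ.real (closedBall (y b) (10 * ρ b)) * (20 * ρ b) ^ a := by
          refine mul_le_mul_of_nonneg_right ?_ (by positivity)
          exact ENNReal.toReal_mono measure_closedBall_lt_top.ne (Measure.restrict_apply_le _ _)
      _ = _ := by
          rw [Measure.addHaar_real_closedBall _ _ (by positivity), mul_pow,
            Real.mul_rpow (by norm_num) hb0.le]
          ring
  have hsum := Finset.sum_le_sum hterm
  rw [← Finset.mul_sum] at hsum
  linarith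

theorem rpow_mul_inv_pow_rpow_le {p r δ : ℝ} (hp : 1 < p) {k s : ℕ} (hk : k ≤ s) (hr : 0 < r)
    (hrδ : r ≤ δ) :
    (r ^ ((s : ℝ) * (p / (p - 1))) * (r ^ k)⁻¹) ^ p ≤
      max 1 δ ^ (s * p) * r ^ ((s : ℝ) * (p / (p - 1))) := by
  have hp1 : p - 1 ≠ 0 := by linarith
  have hks : (k : ℝ) ≤ s := mod_cast hk
  have hexp : ((s : ℝ) * (p / (p - 1)) - k) * p = (s - k) * p + s * (p / (p - 1)) := by
    field_simp; ring
  rw [← Real.rpow_natCast, ← Real.rpow_neg hr.le, ← Real.rpow_add hr, ← Real.rpow_mul hr.le,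
    ← sub_eq_add_neg, hexp, Real.rpow_add hr]
  refine mul_le_mul_of_nonneg_right ?_ (by positivity)
  calc r ^ (((s : ℝ) - k) * p) ≤ max 1 δ ^ (((s : ℝ) - k) * p) :=
        Real.rpow_le_rpow hr.le (hrδ.trans (le_max_right _ _))
          (mul_nonneg (by linarith) (by linarith))
    _ ≤ max 1 δ ^ (s * p) := by
        refine Real.rpow_le_rpow_of_exponent_le (le_max_left _ _) ?_
        have : (0 : ℝ) ≤ k := k.cast_nonneg
        nlinarith

/-- Superposition of rescaled bumps in disjoint balls: the integral and the Sobolev norm are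
controlled by the same sum. -/
theorem exists_sum_bumps [HasContDiffBump E] {p δ : ℝ} (hp : 1 < p) (s : ℕ) :
    ∃ m C : ℝ, 0 < m ∧ 0 < C ∧ ∀ (u : Finset E) (y : E → E) (ρ : E → ℝ),
      (∀ b ∈ u, 0 < ρ b ∧ ρ b ≤ δ) →
      (u : Set E).PairwiseDisjoint (fun b => closedBall (y b) (ρ b)) →
      ∃ h : E → ℝ, ContDiff ℝ (⊤ : ℕ∞) h ∧
        Function.support h ⊆ ⋃ b ∈ u, ball (y b) (ρ b) ∧
        ∫ x, h x ∂μ =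
          m * ∑ b ∈ u, ρ b ^ ((s : ℝ) * (p / (p - 1))) * ρ b ^ Module.finrank ℝ E ∧
        ∑ k ∈ Finset.range (s + 1), ∫ x, ‖iteratedFDeriv ℝ k h x‖ ^ p ∂μ ≤
          C * ∑ b ∈ u, ρ b ^ ((s : ℝ) * (p / (p - 1))) * ρ b ^ Module.finrank ℝ E := by
  have hp0 : 0 < p := by linarith
  set n := Module.finrank ℝ E
  set a : ℝ := (s : ℝ) * (p / (p - 1))
  let φ : ContDiffBump (0 : E) := ⟨1 / 2, 1, by norm_num, by norm_num⟩
  have hφ : ContDiff ℝ (⊤ : ℕ∞) φ := φ.contDiff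
  obtain ⟨M, hM, hφM⟩ := exists_bound_iteratedFDeriv hφ φ.hasCompactSupport s
  set ω := μ.real (ball (0 : E) 1)
  have hω : 0 < ω :=
    ENNReal.toReal_pos (measure_ball_pos μ 0 one_pos).ne' measure_ball_lt_top.ne
  refine ⟨∫ x, φ x ∂μ, (s + 1) * (M ^ p * max 1 δ ^ (s * p) * ω), φ.integral_pos, by positivity,
    fun u y ρ hρ hdisj => ?_⟩
  let g : E → E → ℝ := fun b x => ρ b ^ a * φ ((ρ b)⁻¹ • (x - y b))
  have hscale : ∀ b, ContDiff ℝ (⊤ : ℕ∞) fun x => φ ((ρ b)⁻¹ • (x - y b)) := fun b =>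
    hφ.comp (contDiff_const.smul (contDiff_id.sub contDiff_const))
  have hg : ∀ b, ContDiff ℝ (⊤ : ℕ∞) (g b) := fun b => contDiff_const.mul (hscale b)
  refine ⟨fun x => ∑ b ∈ u, g b x, ContDiff.sum fun b _ => hg b, fun x hx => ?_, ?_, ?_⟩
  · obtain ⟨b, hb, hbx⟩ := Finset.exists_ne_zero_of_sum_ne_zero hx
    have hb0 := (hρ b hb).1
    have h1 : (ρ b)⁻¹ • (x - y b) ∈ Function.support φ := right_ne_zero_of_mul hbx
    rw [φ.support_eq, mem_ball_zero_iff, norm_smul, norm_inv, Real.norm_of_nonneg hb0.le,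
      inv_mul_lt_iff₀ hb0, mul_one] at h1
    exact Set.mem_biUnion hb (by rwa [mem_ball, dist_eq_norm])
  · have hgi : ∀ b ∈ u, Integrable (g b) μ := fun b hb => by
      have hi : Integrable (fun x => φ ((ρ b)⁻¹ • x)) μ :=
        φ.integrable.comp_smul (inv_ne_zero (hρ b hb).1.ne')
      exact (hi.comp_sub_right (y b)).const_mul _
    rw [integral_finsetSum _ hgi, Finset.mul_sum]
    refine Finset.sum_congr rfl fun b hb => ?_
    rw [integral_const_mul, integral_comp_inv_smul_sub μ φ (y b) (hρ b hb).1]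
    ring
  · have hk : ∀ k ∈ Finset.range (s + 1),
        ∫ x, ‖iteratedFDeriv ℝ k (fun x => ∑ b ∈ u, g b x) x‖ ^ p ∂μ ≤
          M ^ p * max 1 δ ^ (s * p) * ω * ∑ b ∈ u, ρ b ^ a * ρ b ^ n := by
      intro k hk
      have hks : k ≤ s := Nat.lt_succ_iff.1 (Finset.mem_range.1 hk)
      have hkn : ((k : ℕ) : WithTop ℕ∞) ≤ ((⊤ : ℕ∞) : WithTop ℕ∞) := mod_cast le_top
      have hnorm : ∀ b ∈ u, ∀ x, ‖iteratedFDeriv ℝ k (g b) x‖ =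
          ρ b ^ a * ((ρ b ^ k)⁻¹ * ‖iteratedFDeriv ℝ k φ ((ρ b)⁻¹ • (x - y b))‖) := by
        intro b hb x
        have hb0 := (hρ b hb).1
        have h1 : iteratedFDeriv ℝ k (g b) x = ρ b ^ a • iteratedFDeriv ℝ k
            (fun x => φ ((ρ b)⁻¹ • (x - y b))) x :=
          iteratedFDeriv_const_smul_apply' (a := ρ b ^ a) ((hscale b).of_le hkn).contDiffAt
        rw [h1, norm_smul, Real.norm_of_nonneg (by positivity),
          norm_iteratedFDeriv_comp_inv_smul_sub (hφ.of_le hkn) _ hb0]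
      have hsum : ∀ x, iteratedFDeriv ℝ k (fun x => ∑ b ∈ u, g b x) x =
          ∑ b ∈ u, iteratedFDeriv ℝ k (g b) x := fun x =>
        iteratedFDeriv_fun_sum_apply fun b _ => ((hg b).of_le hkn).contDiffAt
      simp_rw [hsum]
      have hpos : ∀ b ∈ u, 0 ≤ ρ b ^ a * ((ρ b ^ k)⁻¹ * M) := fun b hb => by
        have hb0 := (hρ b hb).1
        positivity
      refine (integral_norm_sum_rpow_le hp0 hdisj (fun b _ => measurableSet_closedBall)
        (fun b _ => measure_closedBall_lt_top.ne) hpos (fun b hb x hx => ?_)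
        fun b hb x => ?_).trans ?_
      · have hb0 := (hρ b hb).1
        rw [← norm_eq_zero, hnorm b hb]
        have h1 : (ρ b)⁻¹ • (x - y b) ∉ tsupport φ := by
          rw [φ.tsupport_eq, mem_closedBall_zero_iff, norm_smul, norm_inv,
            Real.norm_of_nonneg hb0.le, inv_mul_le_iff₀ hb0, mul_one]
          rwa [mem_closedBall, dist_eq_norm] at hx
        have h2 := Function.notMem_support.1 fun h =>
          h1 (support_iteratedFDeriv_subset (𝕜 := ℝ) k h)
        simp [h2]
      · have hb0 := (hρ b hb).1
        rw [hnorm b hb]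
        gcongr
        exact hφM k hks _
      · rw [Finset.mul_sum]
        refine Finset.sum_le_sum fun b hb => ?_
        have hb0 := (hρ b hb).1
        rw [Measure.addHaar_real_closedBall _ _ hb0.le,
          ← mul_assoc (ρ b ^ a), Real.mul_rpow (by positivity) hM.le]
        have h1 := rpow_mul_inv_pow_rpow_le hp hks hb0 (hρ b hb).2
        calc _ ≤ max 1 δ ^ (s * p) * ρ b ^ a * M ^ p * (ρ b ^ n * ω) := by gcongr
          _ = _ := by ring
    refine (Finset.sum_le_sum hk).trans_eq ?_
    rw [Finset.sum_const, Finset.card_range, nsmul_eq_mul]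
    push_cast
    ring

/-- A smooth function in the Sobolev unit ball that vanishes on `P` and has large integral. -/
theorem exists_fooling_function [HasContDiffBump E] {p δ : ℝ} (hp : 1 < p) {s : ℕ} (hs : 0 < s)
    (hδ : 0 < δ) :
    ∃ c : ℝ, 0 < c ∧ ∀ P : Set E, P.Nonempty → P ⊆ ball 0 δ →
      ∃ f : E → ℝ, ContDiff ℝ (⊤ : ℕ∞) f ∧ Function.support f ⊆ ball 0 δ ∧ (∀ x ∈ P, f x = 0) ∧
        (∑ k ∈ Finset.range (s + 1), ∫ x, ‖iteratedFDeriv ℝ k f x‖ ^ p ∂μ) ^ (1 / p) ≤ 1 ∧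
        c * (∫ x in ball 0 δ, infDist x P ^ ((s : ℝ) * (p / (p - 1))) ∂μ) ^
          (1 / ((s : ℝ) * (p / (p - 1))) * (s : ℝ)) ≤ ∫ x, f x ∂μ := by
  have hp0 : 0 < p := by linarith
  have hp1 : 0 < p - 1 := by linarith
  have hs0 : (0 : ℝ) < s := mod_cast hs
  have hexp : 1 / ((s : ℝ) * (p / (p - 1))) * (s : ℝ) = 1 - 1 / p := by field_simp
  have hexp_pos : 0 < 1 - 1 / p := by
    rw [sub_pos, div_lt_one hp0]; exact hp
  rw [hexp]
  set a : ℝ := (s : ℝ) * (p / (p - 1))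
  have ha0 : 0 < a := by positivity
  obtain ⟨C, hC, hballs⟩ := exists_disjoint_balls_setIntegral_infDist_rpow_le μ hδ ha0
  obtain ⟨m, C', hm, hC', hbumps⟩ := exists_sum_bumps μ (δ := δ) hp s
  refine ⟨m * C' ^ (-(1 / p)) * C ^ (-(1 - 1 / p)), by positivity, fun P hP hPδ => ?_⟩
  have hI0 : 0 ≤ ∫ x in ball 0 δ, infDist x P ^ a ∂μ :=
    integral_nonneg fun x => Real.rpow_nonneg infDist_nonneg a
  rcases hI0.eq_or_lt with hI | hI
  · refine ⟨0, contDiff_const, by simp, by simp, ?_, ?_⟩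
    · simp [Real.zero_rpow hp0.ne', Real.zero_rpow (inv_ne_zero hp0.ne')]
    · rw [← hI, Real.zero_rpow hexp_pos.ne']
      simp
  obtain ⟨u, y, ρ, hu, hdisj, hle⟩ := hballs P hP hPδ hI
  obtain ⟨h, hh, hsupp, hint, hsob⟩ :=
    hbumps u y ρ (fun b hb => ⟨(hu b hb).1, (hu b hb).2.1⟩) hdisj
  set S := ∑ b ∈ u, ρ b ^ a * ρ b ^ Module.finrank ℝ E
  have hS0 : 0 < S := pos_of_mul_pos_right (hI.trans_le hle) hC.le
  set l := (C' * S) ^ (-(1 / p)) with hl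
  have hl0 : 0 < l := by positivity
  have hlp : l ^ p * (C' * S) = 1 := by
    rw [hl, ← Real.rpow_mul (by positivity), show -(1 / p) * p = -1 by field_simp,
      Real.rpow_neg_one, inv_mul_cancel₀ (by positivity)]
  refine ⟨fun x => l * h x, contDiff_const.mul hh, fun x hx => ?_, fun x hx => ?_, ?_, ?_⟩
  · obtain ⟨b, hb, hxb⟩ := Set.mem_iUnion₂.1 (hsupp (right_ne_zero_of_mul hx))
    exact (hu b hb).2.2.1 hxb
  · by_contra hne
    obtain ⟨b, hb, hxb⟩ := Set.mem_iUnion₂.1 (hsupp (right_ne_zero_of_mul hne))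
    exact Set.disjoint_left.1 (hu b hb).2.2.2 hxb hx
  · refine Real.rpow_le_one ?_ ?_ (by positivity)
    · exact Finset.sum_nonneg fun k _ => integral_nonneg fun x => by positivity
    have hk : ∀ k ∈ Finset.range (s + 1), ∫ x, ‖iteratedFDeriv ℝ k (fun x => l * h x) x‖ ^ p ∂μ =
        l ^ p * ∫ x, ‖iteratedFDeriv ℝ k h x‖ ^ p ∂μ := by
      intro k _
      rw [← integral_const_mul]
      congr 1 with x
      have h1 : iteratedFDeriv ℝ k (fun x => l * h x) x = l • iteratedFDeriv ℝ k h x :=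
        iteratedFDeriv_const_smul_apply' (a := l) (hh.of_le (mod_cast le_top)).contDiffAt
      rw [h1, norm_smul, Real.norm_of_nonneg hl0.le, Real.mul_rpow hl0.le (norm_nonneg _)]
    rw [Finset.sum_congr rfl hk, ← Finset.mul_sum, ← hlp]
    gcongr
  · rw [integral_const_mul, hint]
    have h1 := Real.rpow_le_rpow hI0 hle hexp_pos.le
    rw [Real.mul_rpow hC.le hS0.le] at h1
    have hCC : C ^ (-(1 - 1 / p)) * C ^ (1 - 1 / p) = 1 := by
      rw [← Real.rpow_add hC]; simp
    have hSS : S ^ (1 - 1 / p) = S ^ (-(1 / p)) * S := by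
      rw [sub_eq_neg_add, Real.rpow_add hS0, Real.rpow_one]
    calc _ ≤ m * C' ^ (-(1 / p)) * C ^ (-(1 - 1 / p)) * (C ^ (1 - 1 / p) * S ^ (1 - 1 / p)) := by
          gcongr
      _ = m * C' ^ (-(1 / p)) * (C ^ (-(1 - 1 / p)) * C ^ (1 - 1 / p)) * S ^ (1 - 1 / p) := by ring
      _ = l * (m * S) := by
          rw [hCC, hSS, hl, Real.mul_rpow hC'.le hS0.le]
          ring

end FoolingFunction

/-- lower bound for cubature on a Euclidean ball: for any nodes `P` and
weights `w`, some smooth function supported in `B` with Sobolev norm at most one is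
integrated with error at least `c · ‖dist(·,P)‖_{L_{s p*}(B)}^s`. -/
theorem integration_lower_bound_on_ball
    (d : ℕ) (hd : 0 < d) (p : ℝ) (hp : 1 < p) (s : ℕ) (hs : (d : ℝ) / p < s)
    (δ : ℝ) (hδ : 0 < δ) :
    ∃ c : ℝ, 0 < c ∧
      ∀ P : Finset (EuclideanSpace ℝ (Fin d)), P.Nonempty →
        ↑P ⊆ ball (0 : EuclideanSpace ℝ (Fin d)) δ →
        ∀ w : EuclideanSpace ℝ (Fin d) → ℝ,
          ∃ f : EuclideanSpace ℝ (Fin d) → ℝ,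
            ContDiff ℝ (⊤ : ℕ∞) f ∧
            Function.support f ⊆ ball (0 : EuclideanSpace ℝ (Fin d)) δ ∧
            (∑ k ∈ Finset.range (s + 1),
                ∫ x, ‖iteratedFDeriv ℝ k f x‖ ^ p) ^ (1 / p) ≤ 1 ∧
            c * (∫ x in ball (0 : EuclideanSpace ℝ (Fin d)) δ,
                    infDist x (P : Set (EuclideanSpace ℝ (Fin d)))
                      ^ ((s : ℝ) * (p / (p - 1)))) ^ (1 / ((s : ℝ) * (p / (p - 1)))
                  * (s : ℝ)) ≤
              |(∫ x in ball (0 : EuclideanSpace ℝ (Fin d)) δ, f x) -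
                ∑ x ∈ P, w x * f x| := by
  have hs0 : 0 < s := by
    have : (0 : ℝ) < s := lt_of_le_of_lt (by positivity) hs
    exact_mod_cast this
  obtain ⟨c, hc, hfool⟩ := exists_fooling_function
    (volume : Measure (EuclideanSpace ℝ (Fin d))) hp hs0 hδ
  refine ⟨c, hc, fun P hP hPδ w => ?_⟩
  obtain ⟨f, hf, hsupp, hfP, hsob, hint⟩ := hfool P hP hPδ
  refine ⟨f, hf, hsupp, hsob, ?_⟩
  rw [setIntegral_eq_integral_of_forall_compl_eq_zero fun x hx =>
      Function.notMem_support.1 fun h => hx (hsupp h),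
    Finset.sum_eq_zero fun x hx => by rw [hfP x hx, mul_zero], sub_zero]
  exact hint.trans (le_abs_self _)
end
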